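/- arXiv:1401.0638 — 3 statements merged into one kernel-verified Lean document; each statement's English description precedes it below -/
import Mathlib

section
/- Let f be continuous on [−1,1] with Chebyshev coefficients a_n. Suppose there exist constants μ_k, γ_k and strictly increasing sequences of positive reals (d_k)_{k≥0} and (ζ_k)_{k≥0}, both tending to infinity and with d_0 > 1, ζ_0 > 1, such that for every N ≥ 1, a_n − Σ_{k=0}^{N−1} μ_k n^{−d_k} − (−1)^n Σ_{k=0}^{N−1} γ_k n^{−ζ_k} = O(n^{−min{d_N, ζ_N}}) as n → ∞. Let (ξ_k)_{k≥0} be the strictly increasing enumeration of the union {d_k : k ≥ 0} ∪ {ζ_k : k ≥ 0}. Then there exist constants ς_{j,k} (j, k ≥ 0), independent of n, such that for every real M > 0, the Clenshaw–Curtis error satisfies E_n^C[f] − Σ_{(j,k): ξ_k + 2j + 1 ≤ M} ς_{j,k} n^{−(ξ_k + 2j + 1)} = o(n^{−M}) as n → ∞ through even values of n. -/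
open Real Filter Finset

/-- The Chebyshev coefficients of `f : [-1,1] → ℝ`:
`a_k = (2/π) ∫_0^π f(cos t) cos(kt) dt`. -/
noncomputable def chebCoeff (f : ℝ → ℝ) (k : ℕ) : ℝ :=
  (2 / π) * ∫ t in (0 : ℝ)..π, f (Real.cos t) * Real.cos ((k : ℝ) * t)

/-- `δ_j = 1/2` if `j = 0` or `j = n`, and `δ_j = 1` otherwise. -/
noncomputable def ccDelta (n j : ℕ) : ℝ := if j = 0 ∨ j = n then 1 / 2 else 1

/-- The Clenshaw–Curtis quadrature weights
`w_j = (4δ_j/n) Σ_{k=0}^{⌊n/2⌋} δ_{2k} cos(2jkπ/n)/(1−4k²)`. -/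
noncomputable def ccWeight (n j : ℕ) : ℝ :=
  (4 * ccDelta n j / (n : ℝ)) * ∑ k ∈ Finset.range (n / 2 + 1),
    ccDelta n (2 * k) * Real.cos (2 * (j : ℝ) * (k : ℝ) * π / (n : ℝ)) / (1 - 4 * (k : ℝ) ^ 2)

/-- The `(n+1)`-point Clenshaw–Curtis quadrature rule
`I_n^C[f] = Σ_{j=0}^{n} w_j f(cos(jπ/n))`. -/
noncomputable def ccQuad (f : ℝ → ℝ) (n : ℕ) : ℝ :=
  ∑ j ∈ Finset.range (n + 1), ccWeight n j * f (Real.cos ((j : ℝ) * π / (n : ℝ)))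

/-- The Clenshaw–Curtis quadrature error `E_n^C[f] = ∫_{-1}^1 f − I_n^C[f]`. -/
noncomputable def ccError (f : ℝ → ℝ) (n : ℕ) : ℝ :=
  (∫ x in (-1 : ℝ)..1, f x) - ccQuad f n

lemma sum_inv_factorial_add_two_le (n : ℕ) :
    ∑ j ∈ range n, (1 : ℚ) / (j + 2).factorial ≤ 1 - 1 / (n + 1).factorial := by
  induction n with
  | zero => simp
  | succ n ih =>
    rw [sum_range_succ]
    have h1 : (0 : ℚ) < (n + 1).factorial := by positivity
    have h2 : ((n + 2).factorial : ℚ) = (n + 2) * (n + 1).factorial := by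
      rw [Nat.factorial_succ (n + 1)]; push_cast; ring
    have h3 : (1 : ℚ) / (n + 2).factorial ≤ 1 / (n + 1).factorial - 1 / (n + 2).factorial := by
      rw [h2, le_sub_iff_add_le, ← add_div, div_le_div_iff₀ (by positivity) h1]
      have : (0 : ℚ) ≤ n * (n + 1).factorial := by positivity
      linarith
    linarith

lemma abs_bernoulli_le_factorial (n : ℕ) : |bernoulli n| ≤ n.factorial := by
  induction n using Nat.strong_induction_on with
  | _ n ih =>
    rcases Nat.eq_zero_or_pos n with rfl | hn
    · simp
    have h := sum_bernoulli (n + 1)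
    rw [if_neg (by omega), sum_range_succ, Nat.choose_succ_self_right] at h
    have h1 : |((n + 1 : ℕ) : ℚ) * bernoulli n| ≤ (n + 1).factorial := by
      rw [eq_neg_of_add_eq_zero_right h, abs_neg]
      refine (abs_sum_le_sum_abs _ _).trans ?_
      calc ∑ k ∈ range n, |((n + 1).choose k : ℚ) * bernoulli k|
          ≤ ∑ k ∈ range n, ((n + 1).factorial : ℚ) * (1 / (n - 1 - k + 2).factorial) := by
            refine sum_le_sum fun k hk => ?_
            have hk' := mem_range.mp hk
            rw [abs_mul, Nat.abs_cast, show n - 1 - k + 2 = n + 1 - k by omega, mul_one_div,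
              le_div_iff₀ (by positivity),
              ← Nat.choose_mul_factorial_mul_factorial (show k ≤ n + 1 by omega)]
            push_cast
            have := ih k hk'
            gcongr
        _ = (n + 1).factorial * ∑ j ∈ range n, (1 : ℚ) / (j + 2).factorial := by
            rw [← mul_sum, sum_range_reflect (fun j => (1 : ℚ) / (j + 2).factorial)]
        _ ≤ (n + 1).factorial * 1 := by
            gcongr
            refine (sum_inv_factorial_add_two_le n).trans ?_
            simp
        _ = _ := mul_one _
    rw [abs_mul, Nat.abs_cast, Nat.factorial_succ] at h1
    push_cast at h1
    exact le_of_mul_le_mul_left h1 (by positivity)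

/-- The coefficient of `ν ^ (-2 j)` in the trapezoidal mean of `x ↦ x ^ (2 i)` on `[0, 1]` with
`ν` cells. -/
noncomputable def trapCoeff (i j : ℕ) : ℝ :=
  (bernoulli (2 * j) : ℝ) * ((2 * i + 1).choose (2 * j) : ℝ) / (2 * i + 1)

lemma abs_trapCoeff_le (i j : ℕ) : |trapCoeff i j| ≤ (2 * i + 1 : ℝ) ^ (2 * j) := by
  have h1 : |(bernoulli (2 * j) : ℝ)| ≤ (2 * j).factorial := by
    exact_mod_cast abs_bernoulli_le_factorial (2 * j)
  have h2 : (((2 * j).factorial : ℝ)) * ((2 * i + 1).choose (2 * j) : ℝ)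
      ≤ (2 * i + 1 : ℝ) ^ (2 * j) := by
    have := Nat.descFactorial_le_pow (2 * i + 1) (2 * j)
    rw [Nat.descFactorial_eq_factorial_mul_choose] at this
    exact_mod_cast this
  have h3 : (1 : ℝ) ≤ 2 * i + 1 := by
    have : (0 : ℝ) ≤ i := by positivity
    linarith
  rw [trapCoeff, abs_div, abs_mul, Nat.abs_cast, abs_of_pos (by linarith : (0 : ℝ) < 2 * i + 1)]
  calc |(bernoulli (2 * j) : ℝ)| * ((2 * i + 1).choose (2 * j) : ℝ) / (2 * i + 1)
      ≤ |(bernoulli (2 * j) : ℝ)| * ((2 * i + 1).choose (2 * j) : ℝ) :=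
        div_le_self (by positivity) h3
    _ ≤ (2 * j).factorial * ((2 * i + 1).choose (2 * j) : ℝ) := by gcongr
    _ ≤ _ := h2

/-- The trapezoidal sum over `s = 0, …, ν`, with half weights at both ends. -/
noncomputable def trapSum (ν : ℕ) (g : ℕ → ℝ) : ℝ :=
  ∑ s ∈ range (ν + 1), ccDelta ν s * g s

lemma ccDelta_nonneg (n j : ℕ) : 0 ≤ ccDelta n j := by
  unfold ccDelta; split_ifs <;> norm_num

lemma trapSum_eq {ν : ℕ} (hν : 0 < ν) (g : ℕ → ℝ) :
    trapSum ν g = ∑ s ∈ range ν, g s + g ν / 2 - g 0 / 2 := by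
  obtain ⟨m, rfl⟩ : ∃ m, ν = m + 1 := ⟨ν - 1, by omega⟩
  rw [trapSum, sum_range_succ, sum_range_succ', sum_range_succ']
  have : ∑ k ∈ range m, ccDelta (m + 1) (k + 1) * g (k + 1) = ∑ k ∈ range m, g (k + 1) := by
    refine sum_congr rfl fun k hk => ?_
    have := mem_range.mp hk
    rw [ccDelta, if_neg (by omega), one_mul]
  rw [this]
  simp only [ccDelta]
  norm_num
  ring

lemma trapSum_one {ν : ℕ} (hν : 0 < ν) : trapSum ν (fun _ => 1) = ν := by
  rw [trapSum_eq hν]; simp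

lemma trapSum_mono {ν : ℕ} {g h : ℕ → ℝ} (H : ∀ s ≤ ν, g s ≤ h s) : trapSum ν g ≤ trapSum ν h :=
  sum_le_sum fun s hs =>
    mul_le_mul_of_nonneg_left (H s (by have := mem_range.mp hs; omega)) (ccDelta_nonneg _ _)

lemma trapSum_congr {ν : ℕ} {g h : ℕ → ℝ} (H : ∀ s ≤ ν, g s = h s) : trapSum ν g = trapSum ν h :=
  sum_congr rfl fun s hs => by rw [H s (by have := mem_range.mp hs; omega)]

lemma trapSum_const_mul (ν : ℕ) (c : ℝ) (g : ℕ → ℝ) :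
    trapSum ν (fun s => c * g s) = c * trapSum ν g := by
  simp only [trapSum, mul_sum]
  exact sum_congr rfl fun s _ => by ring

lemma trapSum_add (ν : ℕ) (g h : ℕ → ℝ) :
    trapSum ν (fun s => g s + h s) = trapSum ν g + trapSum ν h := by
  simp only [trapSum, ← sum_add_distrib, mul_add]

lemma trapSum_sub (ν : ℕ) (g h : ℕ → ℝ) :
    trapSum ν (fun s => g s - h s) = trapSum ν g - trapSum ν h := by
  simp only [trapSum, ← sum_sub_distrib, mul_sub]

lemma abs_trapSum_le (ν : ℕ) (g : ℕ → ℝ) : |trapSum ν g| ≤ trapSum ν (fun s => |g s|) := by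
  refine (abs_sum_le_sum_abs _ _).trans (sum_le_sum fun s _ => ?_)
  rw [abs_mul, abs_of_nonneg (ccDelta_nonneg _ _)]

/-- The trapezoidal mean of `x ↦ x ^ (2 i)` on `[0, 1]` with `ν` cells. -/
noncomputable def trapMean (i ν : ℕ) : ℝ :=
  (ν : ℝ)⁻¹ * trapSum ν (fun s => ((s : ℝ) / ν) ^ (2 * i))

lemma trapMean_eq_sum (i : ℕ) {ν : ℕ} (hν : 0 < ν) :
    trapMean i ν = ∑ j ∈ range (i + 1), trapCoeff i j * ((ν : ℝ)⁻¹) ^ (2 * j) := by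
  have hν' : (ν : ℝ) ≠ 0 := by positivity
  have hF : ∑ k ∈ range ν, (k : ℝ) ^ (2 * i) =
      ∑ l ∈ range (2 * i + 1), (bernoulli l : ℝ) * ((2 * i + 1).choose l) *
        (ν : ℝ) ^ (2 * i + 1 - l) / (2 * i + 1) := by
    have := congrArg (fun x : ℚ => (x : ℝ)) (sum_range_pow ν (2 * i))
    push_cast at this
    exact this
  have hsplit : ∀ (m : ℕ) (F : ℕ → ℝ), ∑ l ∈ range (2 * m + 1), F l =
      ∑ j ∈ range (m + 1), F (2 * j) + ∑ j ∈ range m, F (2 * j + 1) := by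
    intro m F
    induction m with
    | zero => simp
    | succ m ih =>
      rw [show 2 * (m + 1) + 1 = 2 * m + 1 + 1 + 1 by ring, sum_range_succ, sum_range_succ, ih,
        sum_range_succ _ (m + 1),
        sum_range_succ (fun j => F (2 * j + 1)) m]
      rw [show 2 * (m + 1) = 2 * m + 1 + 1 by ring]; ring
  rw [hsplit] at hF
  have hodd : ∑ j ∈ range i, (bernoulli (2 * j + 1) : ℝ) * ((2 * i + 1).choose (2 * j + 1)) *
        (ν : ℝ) ^ (2 * i + 1 - (2 * j + 1)) / (2 * i + 1) =
        - (ν : ℝ) ^ (2 * i) / 2 + (0 : ℝ) ^ (2 * i) / 2 := by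
    rcases i with _ | i
    · norm_num
    rw [sum_eq_single 0]
    · have : ((i : ℝ) + 1) * 2 + 1 ≠ 0 := by positivity
      simp
      field_simp
    · intro j _ hj
      rw [bernoulli_eq_zero_of_odd ⟨j, rfl⟩ (by omega)]
      simp
    · simp
  rw [hodd] at hF
  have hT : trapSum ν (fun s => ((s : ℝ) / ν) ^ (2 * i)) = ((ν : ℝ) ^ (2 * i))⁻¹ *
      trapSum ν (fun s => (s : ℝ) ^ (2 * i)) := by
    rw [← trapSum_const_mul]
    exact trapSum_congr fun s _ => by rw [div_pow]; field_simp
  rw [trapMean, hT, trapSum_eq hν, hF]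
  have hc : ((0 : ℕ) : ℝ) = 0 := Nat.cast_zero
  rw [hc]
  have e : ∀ S : ℝ, S + (-(ν : ℝ) ^ (2 * i) / 2 + (0 : ℝ) ^ (2 * i) / 2) + (ν : ℝ) ^ (2 * i) / 2
      - (0 : ℝ) ^ (2 * i) / 2 = S := fun S => by ring
  rw [e, mul_sum, mul_sum]
  refine sum_congr rfl fun j hj => ?_
  have hj' := mem_range.mp hj
  have : (ν : ℝ) ^ (2 * i + 1) = (ν : ℝ) ^ (2 * i + 1 - 2 * j) * (ν : ℝ) ^ (2 * j) := by
    rw [← pow_add]; congr 1; omega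
  have h2 : (ν : ℝ) ^ (2 * i + 1 - 2 * j) = (ν : ℝ) ^ (2 * i) * ν / (ν : ℝ) ^ (2 * j) := by
    rw [eq_div_iff (by positivity), ← this, pow_succ]
  rw [h2, trapCoeff, inv_pow]
  field_simp

lemma abs_trapMean_sub_le (J i : ℕ) {ν : ℕ} (hν : 0 < ν) :
    |trapMean i ν - ∑ j ∈ range J, trapCoeff i j * ((ν : ℝ)⁻¹) ^ (2 * j)| ≤
      (J + 2) * 4 ^ J * (2 * i + 1 : ℝ) ^ (2 * J) * ((ν : ℝ)⁻¹) ^ (2 * J) := by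
  set x : ℝ := (ν : ℝ)⁻¹ with hx
  have hx0 : 0 < x := by positivity
  set y : ℝ := (2 * i + 1) * x with hy
  have hy0 : 0 < y := by positivity
  have hterm : ∀ j, |trapCoeff i j * x ^ (2 * j)| ≤ y ^ (2 * j) := fun j => by
    rw [abs_mul, abs_of_pos (by positivity : 0 < x ^ (2 * j)), hy, mul_pow]
    gcongr
    exact abs_trapCoeff_le i j
  have hRHS : (J + 2) * 4 ^ J * (2 * i + 1 : ℝ) ^ (2 * J) * x ^ (2 * J) =
      (J + 2) * (2 * y) ^ (2 * J) := by
    rw [hy, mul_pow, mul_pow, pow_mul 2 2 J]; norm_num; ring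
  rw [hRHS]
  rcases le_or_gt y (1 / 2) with h | h
  · have htail : ∀ m, |∑ j ∈ Ico J m, trapCoeff i j * x ^ (2 * j)| ≤ 2 * y ^ (2 * J) := by
      intro m
      refine (abs_sum_le_sum_abs _ _).trans ((sum_le_sum fun j _ => hterm j).trans ?_)
      rw [sum_Ico_eq_sum_range]
      have hq : y ^ 2 ≤ 1 / 2 := by nlinarith
      calc ∑ k ∈ range (m - J), y ^ (2 * (J + k))
          = y ^ (2 * J) * ∑ k ∈ range (m - J), (y ^ 2) ^ k := by
            rw [mul_sum]; exact sum_congr rfl fun k _ => by rw [← pow_mul, ← pow_add]; ring_nf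
        _ ≤ y ^ (2 * J) * ∑ k ∈ range (m - J), (1 / 2 : ℝ) ^ k := by gcongr
        _ ≤ y ^ (2 * J) * 2 := by
            gcongr
            simpa using sum_geometric_two_le (m - J)
        _ = _ := mul_comm _ _
    have hmain : |trapMean i ν - ∑ j ∈ range J, trapCoeff i j * x ^ (2 * j)| ≤
        2 * y ^ (2 * J) := by
      rw [trapMean_eq_sum i hν]
      rcases le_total J (i + 1) with hJ | hJ
      · rw [← sum_range_add_sum_Ico _ hJ, add_sub_cancel_left]
        exact htail _
      · have hz : ∑ j ∈ range J, trapCoeff i j * x ^ (2 * j) =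
            ∑ j ∈ range (i + 1), trapCoeff i j * x ^ (2 * j) := by
          symm
          apply sum_subset (range_subset_range.mpr hJ)
          intro j _ hj
          have hj' : i + 1 ≤ j := by simpa using hj
          rw [trapCoeff, Nat.choose_eq_zero_of_lt (by omega)]
          simp
        rw [hz, sub_self, abs_zero]
        positivity
    refine hmain.trans ?_
    have : y ^ (2 * J) ≤ (2 * y) ^ (2 * J) := by gcongr; linarith
    have h3 : (0 : ℝ) ≤ J * (2 * y) ^ (2 * J) := by positivity
    nlinarith
  · have h2y : 1 ≤ 2 * y := by linarith
    have h1 : |trapMean i ν| ≤ 1 := by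
      have ht0 : 0 ≤ trapSum ν (fun s => ((s : ℝ) / ν) ^ (2 * i)) :=
        sum_nonneg fun s _ => mul_nonneg (ccDelta_nonneg _ _) (by positivity)
      have ht1 : trapSum ν (fun s => ((s : ℝ) / ν) ^ (2 * i)) ≤ ν := by
        refine (trapSum_mono fun s hs => ?_).trans_eq (trapSum_one hν)
        have : (s : ℝ) ≤ ν := by exact_mod_cast hs
        exact pow_le_one₀ (by positivity) (div_le_one_of_le₀ this (by positivity))
      rw [trapMean, abs_of_nonneg (by positivity), inv_mul_le_iff₀ (by positivity)]
      simpa using ht1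
    have h2 : |∑ j ∈ range J, trapCoeff i j * x ^ (2 * j)| ≤ J * (2 * y) ^ (2 * J) := by
      refine (abs_sum_le_sum_abs _ _).trans ?_
      calc ∑ j ∈ range J, |trapCoeff i j * x ^ (2 * j)|
          ≤ ∑ j ∈ range J, (2 * y) ^ (2 * J) := by
            refine sum_le_sum fun j hj => (hterm j).trans ?_
            have hj' := mem_range.mp hj
            calc y ^ (2 * j) ≤ (2 * y) ^ (2 * j) := by gcongr; linarith
              _ ≤ _ := pow_le_pow_right₀ h2y (by omega)
        _ = _ := by simp
    have h3 : 1 ≤ (2 * y) ^ (2 * J) := one_le_pow₀ h2y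
    calc _ ≤ |trapMean i ν| + |∑ j ∈ range J, trapCoeff i j * x ^ (2 * j)| := abs_sub _ _
      _ ≤ _ := by nlinarith

/-- `g` has the asymptotic expansion `∑ c j * ν ^ (-2 j)`. -/
def HasEvenExp (c g : ℕ → ℝ) : Prop :=
  ∀ J : ℕ, (fun ν : ℕ => g ν - ∑ j ∈ range J, c j * ((ν : ℝ)⁻¹) ^ (2 * j)) =O[atTop]
    fun ν : ℕ => ((ν : ℝ)⁻¹) ^ (2 * J)

namespace HasEvenExp

lemma congr {c g h : ℕ → ℝ} (hg : HasEvenExp c g) (H : ∀ᶠ ν in atTop, h ν = g ν) :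
    HasEvenExp c h := fun J =>
  (hg J).congr' (H.mono fun ν hν => by simp only [hν]) EventuallyEq.rfl

lemma const_mul {c g : ℕ → ℝ} (a : ℝ) (hg : HasEvenExp c g) :
    HasEvenExp (fun j => a * c j) (fun ν => a * g ν) := fun J =>
  ((hg J).const_mul_left a).congr_left fun ν => by
    rw [mul_sub, mul_sum]; simp only [mul_assoc]

lemma sub {c g c' g' : ℕ → ℝ} (hg : HasEvenExp c g) (hg' : HasEvenExp c' g') :
    HasEvenExp (fun j => c j - c' j) (fun ν => g ν - g' ν) := fun J =>
  ((hg J).sub (hg' J)).congr_left fun ν => by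
    simp only [sub_mul, sum_sub_distrib]; ring

lemma isBigO_one {c g : ℕ → ℝ} (hg : HasEvenExp c g) : g =O[atTop] fun _ => (1 : ℝ) := by
  simpa using hg 0

end HasEvenExp

lemma hasEvenExp_of_weak {c g : ℕ → ℝ}
    (H : ∀ J : ℕ, (fun ν : ℕ => g ν - ∑ j ∈ range J, c j * ((ν : ℝ)⁻¹) ^ (2 * j)) =O[atTop]
      fun ν : ℕ => (ν : ℝ) ^ 2 * ((ν : ℝ)⁻¹) ^ (2 * J)) : HasEvenExp c g := by
  intro J
  have h1 : (fun ν : ℕ => g ν - ∑ j ∈ range (J + 1), c j * ((ν : ℝ)⁻¹) ^ (2 * j)) =O[atTop]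
      fun ν : ℕ => ((ν : ℝ)⁻¹) ^ (2 * J) := by
    refine (H (J + 1)).congr' EventuallyEq.rfl ?_
    filter_upwards [eventually_gt_atTop 0] with ν hν
    have : (ν : ℝ) ≠ 0 := by positivity
    rw [mul_add, pow_add, mul_one, mul_left_comm, ← mul_pow, mul_inv_cancel₀ this, one_pow, mul_one]
  have h2 : (fun ν : ℕ => c J * ((ν : ℝ)⁻¹) ^ (2 * J)) =O[atTop]
      fun ν : ℕ => ((ν : ℝ)⁻¹) ^ (2 * J) := (Asymptotics.isBigO_refl _ _).const_mul_left _
  refine (h1.add h2).congr_left fun ν => ?_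
  rw [sum_range_succ]; ring

/-- The expansion coefficients produced by the recursion `G i = H i + ν ^ (-2) / 4 * G (σ i)`. -/
noncomputable def recCoeff {ι : Type*} (σ : ι → ι) (h : ι → ℕ → ℝ) : ℕ → ι → ℝ
  | 0, i => h i 0
  | j + 1, i => h i (j + 1) + 1 / 4 * recCoeff σ h j (σ i)

lemma hasEvenExp_of_recursion {ι : Type*} (σ : ι → ι) (h : ι → ℕ → ℝ) (G H : ι → ℕ → ℝ)
    (hH : ∀ i, HasEvenExp (h i) (H i))
    (hrec : ∀ i, ∀ᶠ ν : ℕ in atTop, G i ν = H i ν + 1 / 4 * ((ν : ℝ)⁻¹) ^ 2 * G (σ i) ν)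
    (hG : ∀ i, G i =O[atTop] fun ν : ℕ => (ν : ℝ) ^ 2) (i : ι) :
    HasEvenExp (fun j => recCoeff σ h j i) (G i) := by
  refine hasEvenExp_of_weak fun J => ?_
  induction J generalizing i with
  | zero => simpa using hG i
  | succ J ih =>
    have h1 : (fun ν : ℕ => H i ν - ∑ j ∈ range (J + 1), h i j * ((ν : ℝ)⁻¹) ^ (2 * j))
        =O[atTop] fun ν : ℕ => (ν : ℝ) ^ 2 * ((ν : ℝ)⁻¹) ^ (2 * (J + 1)) := by
      refine (hH i (J + 1)).trans (Asymptotics.IsBigO.of_bound 1 ?_)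
      filter_upwards [eventually_gt_atTop 0] with ν hν
      have : (1 : ℝ) ≤ ν := by exact_mod_cast hν
      rw [one_mul, norm_mul]
      refine le_mul_of_one_le_left (norm_nonneg _) ?_
      rw [norm_pow, Real.norm_natCast]
      exact one_le_pow₀ this
    have h2 := (Asymptotics.isBigO_refl (fun ν : ℕ => 1 / 4 * ((ν : ℝ)⁻¹) ^ 2) atTop).mul
      (ih (σ i))
    have h3 : (fun ν : ℕ => 1 / 4 * ((ν : ℝ)⁻¹) ^ 2 * ((ν : ℝ) ^ 2 * ((ν : ℝ)⁻¹) ^ (2 * J)))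
        =O[atTop] fun ν : ℕ => (ν : ℝ) ^ 2 * ((ν : ℝ)⁻¹) ^ (2 * (J + 1)) := by
      refine ((Asymptotics.isBigO_refl (fun ν : ℕ => (ν : ℝ) ^ 2 * ((ν : ℝ)⁻¹) ^ (2 * (J + 1)))
        atTop).const_mul_left (1 / 4 : ℝ)).congr_left fun ν => ?_
      ring
    refine (h1.add (h2.trans h3)).congr' ?_ EventuallyEq.rfl
    filter_upwards [hrec i] with ν hν
    have e : ∑ j ∈ range (J + 1), recCoeff σ h j i * ((ν : ℝ)⁻¹) ^ (2 * j) =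
        ∑ j ∈ range (J + 1), h i j * ((ν : ℝ)⁻¹) ^ (2 * j) + 1 / 4 * ((ν : ℝ)⁻¹) ^ 2 *
          ∑ j ∈ range J, recCoeff σ h j (σ i) * ((ν : ℝ)⁻¹) ^ (2 * j) := by
      rw [sum_range_succ', sum_range_succ' (fun j => h i j * ((ν : ℝ)⁻¹) ^ (2 * j)), mul_sum,
        add_right_comm, ← sum_add_distrib]
      simp only [recCoeff]
      congr 1
      refine sum_congr rfl fun j _ => ?_
      rw [mul_add, pow_add]; ring
    rw [e, hν]; ring

/-- Geometric decay of the coefficients of an even power series. -/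
def GeomBound (φ : ℕ → ℝ) : Prop := ∃ C : ℝ, ∀ i, |φ i| ≤ C * (1 / 2) ^ i

lemma GeomBound.shift {φ : ℕ → ℝ} (h : GeomBound φ) : GeomBound (fun i => φ (i + 1)) := by
  obtain ⟨C, hC⟩ := h
  exact ⟨C * (1 / 2), fun i => (hC (i + 1)).trans_eq (by ring)⟩

lemma GeomBound.summable_mul {φ a : ℕ → ℝ} (h : GeomBound φ) (K : ℕ)
    (ha : ∀ i : ℕ, |a i| ≤ (2 * i + 1 : ℝ) ^ K) : Summable (fun i => φ i * a i) := by
  obtain ⟨C, hC⟩ := h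
  have hC0 : 0 ≤ C := by simpa using (abs_nonneg _).trans (hC 0)
  have hs : Summable (fun i : ℕ => C * 2 * (2 ^ K * (((i + 1 : ℕ) : ℝ) ^ K * (1 / 2) ^ (i + 1)))) :=
    (((summable_nat_add_iff 1).mpr (summable_pow_mul_geometric_of_norm_lt_one K
      (r := (1 / 2 : ℝ)) (by norm_num))).mul_left _).mul_left _
  refine Summable.of_norm_bounded hs fun i => ?_
  rw [norm_mul, Real.norm_eq_abs, Real.norm_eq_abs]
  calc |φ i| * |a i| ≤ C * (1 / 2) ^ i * (2 * (i + 1 : ℕ)) ^ K := by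
        gcongr
        · exact hC i
        · refine (ha i).trans ?_
          push_cast
          gcongr
          linarith
    _ = _ := by rw [mul_pow, pow_succ]; ring

/-- The even power series with coefficients `φ`. -/
noncomputable def evenSeries (φ : ℕ → ℝ) (x : ℝ) : ℝ := ∑' i, φ i * x ^ (2 * i)

lemma GeomBound.summable_evenSeries {φ : ℕ → ℝ} (h : GeomBound φ) {x : ℝ} (hx : |x| ≤ 1) :
    Summable (fun i => φ i * x ^ (2 * i)) :=
  h.summable_mul 0 fun i => by
    rw [abs_pow, pow_zero]; exact pow_le_one₀ (abs_nonneg _) hx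

lemma abs_natCast_div_le_one {s ν : ℕ} (h : s ≤ ν) : |(s : ℝ) / ν| ≤ 1 := by
  rw [abs_of_nonneg (by positivity)]
  exact div_le_one_of_le₀ (by exact_mod_cast h) (by positivity)

lemma GeomBound.evenSeries_eq {φ : ℕ → ℝ} (h : GeomBound φ) {x : ℝ} (hx : |x| ≤ 1) :
    evenSeries φ x = φ 0 + x ^ 2 * evenSeries (fun i => φ (i + 1)) x := by
  rw [evenSeries, (h.summable_evenSeries hx).tsum_eq_zero_add, evenSeries, ← tsum_mul_left]
  simp only [mul_zero, pow_zero, mul_one]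
  congr 2
  ext i
  rw [mul_add, pow_add]; ring

lemma GeomBound.abs_evenSeries_le {φ : ℕ → ℝ} (h : GeomBound φ) :
    ∃ C, ∀ x, |x| ≤ 1 → |evenSeries φ x| ≤ C := by
  have hs : Summable (fun i => |φ i|) := by
    simpa using (h.summable_mul (a := fun _ => 1) 0 (by simp)).abs
  refine ⟨∑' i, |φ i|, fun x hx => ?_⟩
  have h1 := h.summable_evenSeries hx
  refine (norm_tsum_le_tsum_norm h1.norm).trans (h1.norm.tsum_le_tsum (fun i => ?_) hs)
  rw [norm_mul, norm_pow, Real.norm_eq_abs, Real.norm_eq_abs]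
  exact mul_le_of_le_one_right (abs_nonneg _) (pow_le_one₀ (abs_nonneg _) hx)

/-- The trapezoidal mean of the even power series `φ` on `[0, 1]` with `ν` cells. -/
noncomputable def seriesMean (φ : ℕ → ℝ) (ν : ℕ) : ℝ :=
  (ν : ℝ)⁻¹ * trapSum ν (fun s => evenSeries φ ((s : ℝ) / ν))

lemma GeomBound.hasSum_seriesMean {φ : ℕ → ℝ} (h : GeomBound φ) (ν : ℕ) :
    HasSum (fun i => φ i * trapMean i ν) (seriesMean φ ν) := by
  have h1 : HasSum (fun i => ∑ s ∈ range (ν + 1), ccDelta ν s * (φ i * ((s : ℝ) / ν) ^ (2 * i)))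
      (trapSum ν (fun s => evenSeries φ ((s : ℝ) / ν))) :=
    hasSum_sum fun s hs => ((h.summable_evenSeries (abs_natCast_div_le_one
      (by have := mem_range.mp hs; omega))).hasSum).mul_left _
  refine (h1.mul_left (ν : ℝ)⁻¹).congr_fun fun i => ?_
  rw [trapMean, trapSum, mul_sum, mul_sum, mul_sum]
  exact sum_congr rfl fun s _ => by ring

lemma GeomBound.hasEvenExp_seriesMean {φ : ℕ → ℝ} (h : GeomBound φ) :
    HasEvenExp (fun j => ∑' i, φ i * trapCoeff i j) (seriesMean φ) := by
  intro J
  have hs : Summable (fun i : ℕ => |φ i * (2 * i + 1 : ℝ) ^ (2 * J)|) :=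
    (h.summable_mul (a := fun i => (2 * i + 1 : ℝ) ^ (2 * J)) (2 * J) fun i =>
      (abs_of_nonneg (by positivity)).le).abs
  set D := ∑' i : ℕ, |φ i * (2 * i + 1 : ℝ) ^ (2 * J)|
  refine Asymptotics.IsBigO.of_bound ((J + 2) * 4 ^ J * D) ?_
  filter_upwards [eventually_gt_atTop 0] with ν hν
  have h1 : HasSum (fun i => φ i * (trapMean i ν - ∑ j ∈ range J, trapCoeff i j *
      ((ν : ℝ)⁻¹) ^ (2 * j))) (seriesMean φ ν - ∑ j ∈ range J,
        (∑' i, φ i * trapCoeff i j) * ((ν : ℝ)⁻¹) ^ (2 * j)) := by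
    have h2 : HasSum (fun i => ∑ j ∈ range J, φ i * trapCoeff i j * ((ν : ℝ)⁻¹) ^ (2 * j))
        (∑ j ∈ range J, (∑' i, φ i * trapCoeff i j) * ((ν : ℝ)⁻¹) ^ (2 * j)) :=
      hasSum_sum fun j _ => ((h.summable_mul (2 * j) fun i => abs_trapCoeff_le i j).hasSum).mul_right _
    refine ((h.hasSum_seriesMean ν).sub h2).congr_fun fun i => ?_
    rw [mul_sub, mul_sum]; simp only [mul_assoc]
  rw [← h1.tsum_eq]
  have hx : (0 : ℝ) ≤ ((ν : ℝ)⁻¹) ^ (2 * J) := by positivity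
  have hD : HasSum (fun i : ℕ => (J + 2) * 4 ^ J * ((ν : ℝ)⁻¹) ^ (2 * J) *
      |φ i * (2 * i + 1 : ℝ) ^ (2 * J)|) ((J + 2) * 4 ^ J * ((ν : ℝ)⁻¹) ^ (2 * J) * D) :=
    hs.hasSum.mul_left _
  refine (tsum_of_norm_bounded hD fun i => ?_).trans_eq ?_
  · rw [norm_mul, Real.norm_eq_abs, Real.norm_eq_abs, abs_mul,
      abs_of_nonneg (by positivity : (0 : ℝ) ≤ (2 * i + 1 : ℝ) ^ (2 * J))]
    calc _ ≤ |φ i| * ((J + 2) * 4 ^ J * (2 * i + 1 : ℝ) ^ (2 * J) * ((ν : ℝ)⁻¹) ^ (2 * J)) := by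
          gcongr
          exact abs_trapMean_sub_le J i hν
      _ = _ := by ring
  · rw [Real.norm_of_nonneg hx]; ring

/-- The integral over `[-1, 1]` of the Chebyshev polynomial of degree `2 q`. -/
noncomputable def chebInt (q : ℝ) : ℝ := 2 / (1 - 4 * q ^ 2)

lemma one_sub_four_mul_sq_ne_zero (q : ℕ) : (1 : ℝ) - 4 * (q : ℝ) ^ 2 ≠ 0 := by
  have : (1 : ℤ) - 4 * (q : ℤ) ^ 2 ≠ 0 := by omega
  exact_mod_cast this

lemma sq_mul_chebInt (q : ℕ) : (q : ℝ) ^ 2 * chebInt q = (chebInt q - 2) / 4 := by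
  have := one_sub_four_mul_sq_ne_zero q
  rw [chebInt, mul_div_assoc', eq_div_iff (by norm_num), div_mul_eq_mul_div, div_eq_iff this,
    sub_mul, div_mul_cancel₀ _ this]
  ring

lemma abs_chebInt_le (q : ℕ) : |chebInt q| ≤ 2 := by
  have h : (1 : ℝ) ≤ |1 - 4 * (q : ℝ) ^ 2| := by
    have : (1 : ℤ) ≤ |1 - 4 * (q : ℤ) ^ 2| := Int.one_le_abs (by omega)
    exact_mod_cast this
  rw [chebInt, abs_div, abs_two]
  exact div_le_self (by norm_num) h

lemma sum_range_chebInt (ν : ℕ) : ∑ s ∈ range ν, chebInt s = 1 + 1 / (2 * ν - 1) := by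
  induction ν with
  | zero => norm_num
  | succ ν ih =>
    rw [sum_range_succ, ih, chebInt]
    have h1 := one_sub_four_mul_sq_ne_zero ν
    have h2 : (2 * (ν : ℝ) - 1) ≠ 0 := by
      intro h; apply h1; linear_combination (-2 * (ν : ℝ) - 1) * h
    have h3 : (2 * (ν : ℝ) + 1) ≠ 0 := by positivity
    have h4 : (1 : ℝ) - 4 * (ν : ℝ) ^ 2 = -((2 * ν - 1) * (2 * ν + 1)) := by ring
    rw [h4]
    push_cast
    rw [show 2 * ((ν : ℝ) + 1) - 1 = 2 * ν + 1 by ring]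
    field_simp
    ring

lemma trapSum_chebInt {ν : ℕ} (hν : 0 < ν) :
    trapSum ν (fun s => chebInt s) = 2 * ν / (4 * (ν : ℝ) ^ 2 - 1) := by
  rw [trapSum_eq hν, sum_range_chebInt, chebInt, chebInt]
  have h1 := one_sub_four_mul_sq_ne_zero ν
  have h2 : (2 * (ν : ℝ) - 1) ≠ 0 := by
    intro h; apply h1; linear_combination (-2 * (ν : ℝ) - 1) * h
  have h3 : (2 * (ν : ℝ) + 1) ≠ 0 := by positivity
  have h4 : (1 : ℝ) - 4 * (ν : ℝ) ^ 2 = -((2 * ν - 1) * (2 * ν + 1)) := by ring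
  have h5 : 4 * (ν : ℝ) ^ 2 - 1 = ((2 * ν - 1) * (2 * ν + 1)) := by ring
  rw [h4, h5]
  norm_num
  field_simp
  ring

lemma hasEvenExp_trapSum_chebInt :
    HasEvenExp (fun j => 1 / 2 * (1 / 4) ^ j) (fun ν => ν * trapSum ν (fun s => chebInt s)) := by
  intro J
  refine Asymptotics.IsBigO.of_bound 1 ?_
  filter_upwards [eventually_gt_atTop 0] with ν hν
  have hx1 : (ν : ℝ)⁻¹ ≤ 1 := inv_le_one_of_one_le₀ (by exact_mod_cast hν)
  have hν' : (ν : ℝ) ≠ 0 := by positivity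
  set x := (ν : ℝ)⁻¹ with hx
  have hx0 : 0 < x := by positivity
  have hden : 0 < 1 - x ^ 2 / 4 := by nlinarith
  have e1 : (ν : ℝ) * trapSum ν (fun s => chebInt s) = 1 / 2 / (1 - x ^ 2 / 4) := by
    have h1 := one_sub_four_mul_sq_ne_zero ν
    have h1' : 4 * (ν : ℝ) ^ 2 - 1 ≠ 0 := fun h => h1 (by linarith)
    have hx2 : x ^ 2 * (ν : ℝ) ^ 2 = 1 := by rw [← mul_pow, hx, inv_mul_cancel₀ hν', one_pow]
    rw [trapSum_chebInt hν, mul_div_assoc', div_eq_div_iff h1' hden.ne']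
    linear_combination (-1 / 2) * hx2
  have e2 : ∑ j ∈ range J, 1 / 2 * (1 / 4) ^ j * x ^ (2 * j) =
      1 / 2 * ((1 - (x ^ 2 / 4) ^ J) / (1 - x ^ 2 / 4)) := by
    have := mul_neg_geom_sum (x ^ 2 / 4) J
    rw [← this, mul_div_cancel_left₀ _ hden.ne', mul_sum]
    exact sum_congr rfl fun j _ => by rw [div_eq_mul_inv (x ^ 2), mul_pow, ← pow_mul]; norm_num; ring
  have e3 : (x ^ 2 / 4) ^ J = x ^ (2 * J) * (1 / 4) ^ J := by
    rw [div_eq_mul_one_div, mul_pow, ← pow_mul]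
  rw [e1, e2, e3]
  have e4 : 1 / 2 / (1 - x ^ 2 / 4) - 1 / 2 * ((1 - x ^ (2 * J) * (1 / 4) ^ J) / (1 - x ^ 2 / 4)) =
      (1 / 2 * (1 / 4) ^ J) / (1 - x ^ 2 / 4) * x ^ (2 * J) := by ring
  rw [e4, norm_mul]
  gcongr
  rw [Real.norm_of_nonneg (by positivity), div_le_one hden]
  have : (1 / 4 : ℝ) ^ J ≤ 1 := pow_le_one₀ (by norm_num) (by norm_num)
  nlinarith

/-- `ν` times the trapezoidal sum of `chebInt s` against the even power series `φ`. -/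
noncomputable def chebSeriesSum (φ : ℕ → ℝ) (ν : ℕ) : ℝ :=
  ν * trapSum ν (fun s => chebInt s * evenSeries φ ((s : ℝ) / ν))

lemma GeomBound.chebSeriesSum_eq {φ : ℕ → ℝ} (h : GeomBound φ) {ν : ℕ} (hν : 0 < ν) :
    chebSeriesSum φ ν = (φ 0 * (ν * trapSum ν (fun s => chebInt s)) -
      1 / 2 * seriesMean (fun i => φ (i + 1)) ν) +
      1 / 4 * ((ν : ℝ)⁻¹) ^ 2 * chebSeriesSum (fun i => φ (i + 1)) ν := by
  have hν' : (ν : ℝ) ≠ 0 := by positivity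
  have e : trapSum ν (fun s => chebInt s * evenSeries φ ((s : ℝ) / ν)) =
      φ 0 * trapSum ν (fun s => chebInt s) -
      1 / 2 * ((ν : ℝ)⁻¹) ^ 2 * trapSum ν (fun s => evenSeries (fun i => φ (i + 1)) ((s : ℝ) / ν)) +
      1 / 4 * ((ν : ℝ)⁻¹) ^ 2 *
        trapSum ν (fun s => chebInt s * evenSeries (fun i => φ (i + 1)) ((s : ℝ) / ν)) := by
    rw [← trapSum_const_mul, ← trapSum_const_mul, ← trapSum_const_mul, ← trapSum_sub,
      ← trapSum_add]
    refine trapSum_congr fun s hs => ?_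
    rw [h.evenSeries_eq (abs_natCast_div_le_one hs)]
    set Φ := evenSeries (fun i => φ (i + 1)) ((s : ℝ) / ν)
    have := sq_mul_chebInt s
    rw [div_pow]
    field_simp
    linear_combination 8 * Φ * this
  rw [chebSeriesSum, chebSeriesSum, seriesMean, e]
  field_simp

lemma GeomBound.chebSeriesSum_isBigO {φ : ℕ → ℝ} (h : GeomBound φ) :
    chebSeriesSum φ =O[atTop] fun ν : ℕ => (ν : ℝ) ^ 2 := by
  obtain ⟨C, hC⟩ := h.abs_evenSeries_le
  refine Asymptotics.IsBigO.of_bound (2 * C) ?_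
  filter_upwards [eventually_gt_atTop 0] with ν hν
  rw [chebSeriesSum, norm_mul, Real.norm_natCast, norm_pow, Real.norm_natCast, Real.norm_eq_abs]
  have h1 : |trapSum ν (fun s => chebInt s * evenSeries φ ((s : ℝ) / ν))| ≤ 2 * C * ν := by
    conv_rhs => rw [← trapSum_one hν, ← trapSum_const_mul]
    refine (abs_trapSum_le _ _).trans (trapSum_mono fun s hs => ?_)
    rw [abs_mul, mul_one]
    have := hC _ (abs_natCast_div_le_one hs)
    exact mul_le_mul (abs_chebInt_le s) this (abs_nonneg _) (by norm_num)
  calc _ ≤ (ν : ℝ) * (2 * C * ν) := by gcongr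
    _ = _ := by ring

lemma GeomBound.exists_hasEvenExp_chebSeriesSum {φ : ℕ → ℝ} (h : GeomBound φ) :
    ∃ c, HasEvenExp c (chebSeriesSum φ) := by
  refine ⟨_, hasEvenExp_of_recursion (ι := {φ : ℕ → ℝ // GeomBound φ})
    (fun φ => ⟨_, φ.2.shift⟩)
    _ (fun φ => chebSeriesSum φ.1) _
    (fun φ => (hasEvenExp_trapSum_chebInt.const_mul (φ.1 0)).sub
      (φ.2.shift.hasEvenExp_seriesMean.const_mul (1 / 2))) (fun φ => ?_)
    (fun φ => φ.2.chebSeriesSum_isBigO) ⟨φ, h⟩⟩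
  filter_upwards [eventually_gt_atTop 0] with ν hν
  exact φ.2.chebSeriesSum_eq hν

lemma hasSum_one_add_rpow (a : ℝ) {y : ℝ} (hy : |y| < 1) :
    HasSum (fun n => Ring.choose a n * y ^ n) ((1 + y) ^ a) := by
  have hmem : y ∈ Metric.eball (0 : ℝ) 1 := by
    rw [Metric.mem_eball, edist_dist, dist_zero_right, Real.norm_eq_abs]
    exact ENNReal.ofReal_lt_one.mpr hy
  have h := (Real.one_add_rpow_hasFPowerSeriesOnBall_zero (a := a)).hasSum hmem
  simpa [binomialSeries, FormalMultilinearSeries.coeff_ofScalars, mul_comm] using h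

lemma hasSum_one_add_rpow_add_one_sub_rpow (a : ℝ) {y : ℝ} (hy : |y| < 1) :
    HasSum (fun i => 2 * Ring.choose a (2 * i) * y ^ (2 * i)) ((1 + y) ^ a + (1 - y) ^ a) := by
  have h1 := (hasSum_one_add_rpow a hy).add (hasSum_one_add_rpow a (y := -y) (by rwa [abs_neg]))
  rw [← sub_eq_add_neg] at h1
  have hinj : Function.Injective (fun i : ℕ => 2 * i) := fun i j h => by simpa using h
  refine ((hinj.hasSum_iff (fun n hn => ?_)).mpr h1).congr_fun fun i => ?_
  · have : Odd n := by
      rw [← Nat.not_even_iff_odd]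
      rintro ⟨k, hk⟩
      exact hn ⟨k, by simp only []; omega⟩
    rw [this.neg_pow]; ring
  · simp only [Function.comp]
    rw [(even_two_mul i).neg_pow]; ring

lemma exists_abs_choose_two_mul_le (a : ℝ) : ∃ C, ∀ i : ℕ, |Ring.choose a (2 * i)| ≤ C * 2 ^ i := by
  have hs := (hasSum_one_add_rpow_add_one_sub_rpow a (y := 5 / 7)
    (by rw [abs_of_pos] <;> norm_num)).summable
  obtain ⟨C, hC⟩ := hs.abs.tendsto_atTop_zero.bddAbove_range
  refine ⟨C, fun i => ?_⟩
  have h1 : |2 * Ring.choose a (2 * i) * (5 / 7 : ℝ) ^ (2 * i)| ≤ C := hC ⟨i, rfl⟩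
  rw [abs_mul, abs_mul, abs_two, abs_of_pos (by positivity : (0 : ℝ) < (5 / 7) ^ (2 * i)),
    pow_mul] at h1
  have h2 : (1 : ℝ) ≤ 2 ^ i * ((5 / 7) ^ 2) ^ i := by
    rw [← mul_pow]; exact one_le_pow₀ (by norm_num)
  have h3 := abs_nonneg (Ring.choose a (2 * i))
  calc |Ring.choose a (2 * i)| ≤ |Ring.choose a (2 * i)| * (2 ^ i * ((5 / 7) ^ 2) ^ i) :=
        le_mul_of_one_le_right h3 h2
    _ ≤ 2 * |Ring.choose a (2 * i)| * ((5 / 7) ^ 2) ^ i * 2 ^ i := by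
        have : 0 ≤ |Ring.choose a (2 * i)| * ((5 / 7) ^ 2) ^ i * 2 ^ i := by positivity
        linarith
    _ ≤ C * 2 ^ i := by gcongr

/-- The even Taylor coefficients of `x ↦ ∑ p ≥ 1, (2 p + x) ^ (-ξ) + (2 p - x) ^ (-ξ)`. -/
noncomputable def powCoeff (ξ : ℝ) (i : ℕ) : ℝ :=
  2 * Ring.choose (-ξ) (2 * i) *
    ∑' p : ℕ, (2 * (p + 1) : ℝ) ^ (-ξ) * ((2 * (p + 1) : ℝ)⁻¹) ^ (2 * i)

lemma summable_two_mul_add_one_rpow {ξ : ℝ} (hξ : 1 < ξ) :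
    Summable (fun p : ℕ => (2 * (p + 1) : ℝ) ^ (-ξ)) := by
  have h := ((summable_nat_add_iff 1).mpr (Real.summable_nat_rpow.mpr
    (by linarith : -ξ < -1))).mul_left ((2 : ℝ) ^ (-ξ))
  refine h.congr fun p => ?_
  rw [Real.mul_rpow (by norm_num) (by positivity)]
  push_cast
  rfl

lemma inv_two_mul_add_one_pow_le (p i : ℕ) :
    ((2 * (p + 1) : ℝ)⁻¹) ^ (2 * i) ≤ (1 / 4) ^ i := by
  rw [pow_mul]
  gcongr
  have : (2 * (p + 1) : ℝ)⁻¹ ≤ 2⁻¹ := by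
    gcongr
    have : (0 : ℝ) ≤ p := by positivity
    linarith
  calc ((2 * (p + 1) : ℝ)⁻¹) ^ 2 ≤ (2⁻¹) ^ 2 := by gcongr
    _ = 1 / 4 := by norm_num

lemma geomBound_powCoeff {ξ : ℝ} (hξ : 1 < ξ) : GeomBound (powCoeff ξ) := by
  obtain ⟨C, hC⟩ := exists_abs_choose_two_mul_le (-ξ)
  have hs := summable_two_mul_add_one_rpow hξ
  set S := ∑' p : ℕ, (2 * (p + 1) : ℝ) ^ (-ξ)
  have hC0 : 0 ≤ C := by simpa using (abs_nonneg _).trans (hC 0)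
  refine ⟨2 * C * S, fun i => ?_⟩
  have h1 : ‖∑' p : ℕ, (2 * (p + 1) : ℝ) ^ (-ξ) * ((2 * (p + 1) : ℝ)⁻¹) ^ (2 * i)‖ ≤
      S * (1 / 4) ^ i := by
    refine tsum_of_norm_bounded (hs.hasSum.mul_right _) fun p => ?_
    rw [Real.norm_of_nonneg (by positivity)]
    gcongr
    exact inv_two_mul_add_one_pow_le p i
  rw [powCoeff, abs_mul, abs_mul, abs_two]
  calc _ ≤ 2 * (C * 2 ^ i) * (S * (1 / 4) ^ i) := by
        gcongr
        · exact hC i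
        · exact h1
    _ = 2 * C * S * (2 * (1 / 4)) ^ i := by rw [mul_pow]; ring
    _ = _ := by norm_num

lemma hasSum_evenSeries_powCoeff {ξ x : ℝ} (hξ : 1 < ξ) (hx : |x| ≤ 1) :
    HasSum (fun p : ℕ => (2 * (p + 1) + x) ^ (-ξ) + (2 * (p + 1) - x) ^ (-ξ))
      (evenSeries (powCoeff ξ) x) := by
  obtain ⟨C, hC⟩ := exists_abs_choose_two_mul_le (-ξ)
  have hC0 : 0 ≤ C := by simpa using (abs_nonneg _).trans (hC 0)
  have hs := summable_two_mul_add_one_rpow hξ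
  set F : ℕ × ℕ → ℝ := fun q => (2 * (q.1 + 1) : ℝ) ^ (-ξ) *
    (2 * Ring.choose (-ξ) (2 * q.2) * (x * (2 * (q.1 + 1) : ℝ)⁻¹) ^ (2 * q.2)) with hF
  have hsum : Summable F := by
    have hb := (hs.mul_of_nonneg (summable_geometric_two) (fun _ => by positivity)
      (fun _ => by positivity)).mul_left (2 * C)
    refine Summable.of_norm_bounded hb fun q => ?_
    have h0 : (0 : ℝ) < 2 * (q.1 + 1) := by positivity
    have hxx : |x| ^ (2 * q.2) ≤ 1 := pow_le_one₀ (abs_nonneg _) hx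
    rw [hF, Real.norm_eq_abs, abs_mul, abs_mul, abs_mul, abs_two, abs_pow, abs_mul, mul_pow,
      abs_of_nonneg (by positivity : (0 : ℝ) ≤ (2 * (q.1 + 1) : ℝ) ^ (-ξ)), abs_of_pos (inv_pos.mpr h0)]
    calc _ ≤ (2 * (q.1 + 1) : ℝ) ^ (-ξ) * (2 * (C * 2 ^ q.2) * (1 * (1 / 4) ^ q.2)) := by
          gcongr
          · exact hC _
          · exact inv_two_mul_add_one_pow_le _ _
      _ = 2 * C * ((2 * (q.1 + 1) : ℝ) ^ (-ξ) * (2 * (1 / 4)) ^ q.2) := by rw [mul_pow]; ring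
      _ = _ := by norm_num
  have h1 : ∀ p : ℕ, HasSum (fun i => F (p, i))
      ((2 * (p + 1) + x) ^ (-ξ) + (2 * (p + 1) - x) ^ (-ξ)) := by
    intro p
    have hP : (0 : ℝ) < 2 * (p + 1) := by positivity
    have hP2 : (2 : ℝ) ≤ 2 * (p + 1) := by
      have : (0 : ℝ) ≤ p := by positivity
      linarith
    have hy : |x * (2 * (p + 1) : ℝ)⁻¹| < 1 := by
      rw [abs_mul, abs_of_pos (inv_pos.mpr hP), ← div_eq_mul_inv, div_lt_one hP]
      linarith
    have hy' := abs_lt.mp hy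
    have e : (2 * (p + 1) + x : ℝ) ^ (-ξ) + (2 * (p + 1) - x) ^ (-ξ) = (2 * (p + 1) : ℝ) ^ (-ξ) *
        ((1 + x * (2 * (p + 1) : ℝ)⁻¹) ^ (-ξ) + (1 - x * (2 * (p + 1) : ℝ)⁻¹) ^ (-ξ)) := by
      rw [mul_add ((2 * (p + 1) : ℝ) ^ (-ξ)), ← Real.mul_rpow hP.le (by linarith [hy'.1]),
        ← Real.mul_rpow hP.le (by linarith [hy'.2])]
      congr 2 <;> field_simp
    rw [e]
    exact (hasSum_one_add_rpow_add_one_sub_rpow (-ξ) hy).mul_left _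
  have h2 : evenSeries (powCoeff ξ) x = ∑' q, F q := by
    rw [hsum.tsum_prod, ← Summable.tsum_comm (f := fun p i => F (p, i)) hsum, evenSeries]
    refine tsum_congr fun i => ?_
    rw [powCoeff, mul_assoc, ← tsum_mul_right, ← tsum_mul_left]
    exact tsum_congr fun p => by simp only [hF]; rw [mul_pow]; ring
  rw [h2]
  exact hsum.hasSum.prod_fiberwise h1

/-- The trapezoidal sum of `G q s` over the indices `q` with `|q - 2 ν (p + 1)| = s ≤ ν`. -/
noncomputable def blockTerm (ν : ℕ) (G : ℕ → ℕ → ℝ) (p : ℕ) : ℝ :=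
  trapSum ν (fun s => G (2 * ν * (p + 1) + s) s + G (2 * ν * (p + 1) - s) s)

/-- The sum of `blockTerm` over all blocks. -/
noncomputable def blockSum (ν : ℕ) (G : ℕ → ℕ → ℝ) : ℝ := ∑' p, blockTerm ν G p

lemma le_block_index {ν s : ℕ} (hs : s ≤ ν) (p : ℕ) :
    ν ≤ 2 * ν * (p + 1) + s ∧ ν ≤ 2 * ν * (p + 1) - s := by
  have : 2 * ν * (p + 1) = 2 * (ν * p) + 2 * ν := by ring
  omega

lemma blockTerm_congr {ν : ℕ} {G H : ℕ → ℕ → ℝ} (h : ∀ q s, ν ≤ q → s ≤ ν → G q s = H q s)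
    (p : ℕ) : blockTerm ν G p = blockTerm ν H p :=
  trapSum_congr fun s hs => by
    rw [h _ s (le_block_index hs p).1 hs, h _ s (le_block_index hs p).2 hs]

lemma blockTerm_add (ν : ℕ) (G H : ℕ → ℕ → ℝ) (p : ℕ) :
    blockTerm ν (fun q s => G q s + H q s) p = blockTerm ν G p + blockTerm ν H p := by
  rw [blockTerm, blockTerm, blockTerm, ← trapSum_add]
  exact trapSum_congr fun s _ => by ring

lemma blockTerm_const_mul (ν : ℕ) (c : ℝ) (G : ℕ → ℕ → ℝ) (p : ℕ) :
    blockTerm ν (fun q s => c * G q s) p = c * blockTerm ν G p := by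
  rw [blockTerm, blockTerm, ← trapSum_const_mul]
  exact trapSum_congr fun s _ => by ring

lemma hasSum_blockTerm_rpow_mul {ξ : ℝ} (hξ : 1 < ξ) {ν : ℕ} (hν : 0 < ν) (w : ℕ → ℝ) :
    HasSum (blockTerm ν (fun q s => (q : ℝ) ^ (-ξ) * w s))
      ((ν : ℝ) ^ (-ξ) * trapSum ν (fun s => w s * evenSeries (powCoeff ξ) ((s : ℝ) / ν))) := by
  have hν' : (0 : ℝ) < ν := by exact_mod_cast hν
  have h : HasSum (fun p : ℕ => ∑ s ∈ range (ν + 1), ccDelta ν s * ((ν : ℝ) ^ (-ξ) * (w s *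
      ((2 * (p + 1) + (s : ℝ) / ν) ^ (-ξ) + (2 * (p + 1) - (s : ℝ) / ν) ^ (-ξ)))))
      (∑ s ∈ range (ν + 1), ccDelta ν s * ((ν : ℝ) ^ (-ξ) * (w s *
        evenSeries (powCoeff ξ) ((s : ℝ) / ν)))) :=
    hasSum_sum fun s hs => (((hasSum_evenSeries_powCoeff hξ (abs_natCast_div_le_one
      (by have := mem_range.mp hs; omega))).mul_left _).mul_left _).mul_left _
  rw [← trapSum_const_mul]
  refine h.congr_fun fun p => ?_
  rw [blockTerm]
  refine trapSum_congr fun s hs => ?_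
  have hs1 : (s : ℝ) / ν ≤ 1 := (abs_le.mp (abs_natCast_div_le_one hs)).2
  have hs0 : 0 ≤ (s : ℝ) / ν := by positivity
  have hp0 : (0 : ℝ) ≤ p := by positivity
  have hle : s ≤ 2 * ν * (p + 1) := by
    have : 2 * ν * (p + 1) = 2 * (ν * p) + 2 * ν := by ring
    omega
  rw [Nat.cast_sub hle]
  push_cast
  have e1 : (2 * ν * (p + 1) + s : ℝ) = ν * (2 * (p + 1) + (s : ℝ) / ν) := by field_simp
  have e2 : (2 * ν * (p + 1) - s : ℝ) = ν * (2 * (p + 1) - (s : ℝ) / ν) := by field_simp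
  rw [e1, e2, Real.mul_rpow hν'.le (by positivity), Real.mul_rpow hν'.le (by linarith)]
  ring

lemma hasSum_blockTerm_rpow {ξ : ℝ} (hξ : 1 < ξ) {ν : ℕ} (hν : 0 < ν) :
    HasSum (blockTerm ν (fun q _ => (q : ℝ) ^ (-ξ)))
      ((ν : ℝ) ^ (1 - ξ) * seriesMean (powCoeff ξ) ν) := by
  have hν' : (0 : ℝ) < ν := by exact_mod_cast hν
  have h := hasSum_blockTerm_rpow_mul hξ hν (fun _ => 1)
  simp only [mul_one, one_mul] at h
  convert h using 1
  rw [seriesMean, sub_eq_add_neg, Real.rpow_add hν', Real.rpow_one]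
  field_simp

lemma norm_blockTerm_le {ξ C : ℝ} {ν : ℕ} {G : ℕ → ℕ → ℝ}
    (hG : ∀ q s : ℕ, ν ≤ q → s ≤ ν → |G q s| ≤ C * (q : ℝ) ^ (-ξ)) (p : ℕ) :
    ‖blockTerm ν G p‖ ≤ C * blockTerm ν (fun q _ => (q : ℝ) ^ (-ξ)) p := by
  rw [← blockTerm_const_mul]
  refine (abs_trapSum_le _ _).trans (trapSum_mono fun s hs => (abs_add_le _ _).trans ?_)
  exact add_le_add (hG _ s (le_block_index hs p).1 hs) (hG _ s (le_block_index hs p).2 hs)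

lemma summable_blockTerm {ξ C : ℝ} (hξ : 1 < ξ) {ν : ℕ} (hν : 0 < ν) {G : ℕ → ℕ → ℝ}
    (hG : ∀ q s : ℕ, ν ≤ q → s ≤ ν → |G q s| ≤ C * (q : ℝ) ^ (-ξ)) :
    Summable (blockTerm ν G) :=
  Summable.of_norm_bounded ((hasSum_blockTerm_rpow hξ hν).summable.mul_left C)
    (norm_blockTerm_le hG)

lemma abs_blockSum_le {ξ C : ℝ} (hξ : 1 < ξ) {ν : ℕ} (hν : 0 < ν) {G : ℕ → ℕ → ℝ}
    (hG : ∀ q s : ℕ, ν ≤ q → s ≤ ν → |G q s| ≤ C * (q : ℝ) ^ (-ξ)) :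
    |blockSum ν G| ≤ C * ((ν : ℝ) ^ (1 - ξ) * seriesMean (powCoeff ξ) ν) :=
  tsum_of_norm_bounded ((hasSum_blockTerm_rpow hξ hν).mul_left C) (norm_blockTerm_le hG)

lemma blockSum_isBigO {ξ C : ℝ} (hξ : 1 < ξ) {G : ℕ → ℕ → ℝ}
    (hG : ∀ᶠ q : ℕ in atTop, ∀ s, |G q s| ≤ C * (q : ℝ) ^ (-ξ)) :
    (fun ν => blockSum ν G) =O[atTop] fun ν : ℕ => (ν : ℝ) ^ (1 - ξ) := by
  obtain ⟨q₀, hq₀⟩ := eventually_atTop.mp hG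
  have h1 : (fun ν => blockSum ν G) =O[atTop]
      fun ν : ℕ => (ν : ℝ) ^ (1 - ξ) * seriesMean (powCoeff ξ) ν := by
    refine Asymptotics.IsBigO.of_bound |C| ?_
    filter_upwards [eventually_ge_atTop q₀, eventually_gt_atTop 0] with ν hν hν0
    have := abs_blockSum_le hξ hν0 (G := G) (C := C) fun q s hq _ => hq₀ q (hν.trans hq) s
    refine this.trans ((le_abs_self _).trans_eq ?_)
    rw [abs_mul]; rfl
  simpa using h1.trans ((Asymptotics.isBigO_refl _ _).mul
    (geomBound_powCoeff hξ).hasEvenExp_seriesMean.isBigO_one)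

lemma abs_rpow_mul_chebInt_le (ξ : ℝ) (q : ℕ) :
    |(q : ℝ) ^ (-ξ) * chebInt q| ≤ 2 * (q : ℝ) ^ (-ξ) := by
  rw [abs_mul, abs_of_nonneg (by positivity : (0 : ℝ) ≤ (q : ℝ) ^ (-ξ)), mul_comm]
  gcongr
  exact abs_chebInt_le q

lemma blockSum_rpow_mul_chebInt {ξ : ℝ} (hξ : 1 < ξ) {ν : ℕ} (hν : 0 < ν) :
    (ν : ℝ) ^ (ξ + 1) * blockSum ν (fun q _ => (q : ℝ) ^ (-ξ) * chebInt q) =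
      -1 / 2 * seriesMean (powCoeff (ξ + 2)) ν + 1 / 4 * ((ν : ℝ)⁻¹) ^ 2 *
      ((ν : ℝ) ^ (ξ + 2 + 1) * blockSum ν (fun q _ => (q : ℝ) ^ (-(ξ + 2)) * chebInt q)) := by
  have hν' : (0 : ℝ) < ν := by exact_mod_cast hν
  have hξ2 : 1 < ξ + 2 := by linarith
  have h1 := (hasSum_blockTerm_rpow hξ2 hν).mul_left (-1 / 2)
  have h2 := (summable_blockTerm hξ2 hν (G := fun q _ => (q : ℝ) ^ (-(ξ + 2)) * chebInt q)
    fun q s _ _ => abs_rpow_mul_chebInt_le _ q).hasSum.mul_left (1 / 4)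
  have h3 : blockSum ν (fun q _ => (q : ℝ) ^ (-ξ) * chebInt q) =
      -1 / 2 * ((ν : ℝ) ^ (1 - (ξ + 2)) * seriesMean (powCoeff (ξ + 2)) ν) +
        1 / 4 * blockSum ν (fun q _ => (q : ℝ) ^ (-(ξ + 2)) * chebInt q) := by
    refine ((h1.add h2).congr_fun fun p => ?_).tsum_eq
    rw [← blockTerm_const_mul, ← blockTerm_const_mul, ← blockTerm_add]
    refine blockTerm_congr (fun q s hq _ => ?_) p
    have hq' : (0 : ℝ) < q := by exact_mod_cast hν.trans_le hq
    have e : (q : ℝ) ^ (-ξ) = (q : ℝ) ^ (-(ξ + 2)) * (q : ℝ) ^ 2 := by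
      rw [← Real.rpow_natCast, ← Real.rpow_add hq']; congr 1; push_cast; ring
    rw [e, mul_assoc, sq_mul_chebInt]; ring
  have e1 : (ν : ℝ) ^ (ξ + 1) * (ν : ℝ) ^ (1 - (ξ + 2)) = 1 := by
    rw [← Real.rpow_add hν', show ξ + 1 + (1 - (ξ + 2)) = 0 by ring, Real.rpow_zero]
  have e2 : ((ν : ℝ)⁻¹) ^ 2 * (ν : ℝ) ^ (ξ + 2 + 1) = (ν : ℝ) ^ (ξ + 1) := by
    rw [show ξ + 2 + 1 = ξ + 1 + (2 : ℕ) by push_cast; ring, Real.rpow_add hν', Real.rpow_natCast,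
      inv_pow]
    field_simp
  rw [h3, mul_add]
  linear_combination (-1 / 2 * seriesMean (powCoeff (ξ + 2)) ν) * e1 -
    1 / 4 * blockSum ν (fun q _ => (q : ℝ) ^ (-(ξ + 2)) * chebInt q) * e2

lemma exists_hasEvenExp_blockSum_rpow_mul_chebInt {ξ : ℝ} (hξ : 1 < ξ) :
    ∃ c, HasEvenExp c (fun ν : ℕ =>
      (ν : ℝ) ^ (ξ + 1) * blockSum ν (fun q _ => (q : ℝ) ^ (-ξ) * chebInt q)) := by
  refine ⟨_, hasEvenExp_of_recursion (ι := {ξ : ℝ // 1 < ξ})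
    (fun η => ⟨η.1 + 2, by linarith [η.2]⟩) _
    (fun η (ν : ℕ) =>
      (ν : ℝ) ^ (η.1 + 1) * blockSum ν (fun q _ => (q : ℝ) ^ (-η.1) * chebInt q)) _
    (fun η => ((geomBound_powCoeff (ξ := η.1 + 2) (by linarith [η.2])).hasEvenExp_seriesMean).const_mul
      (-1 / 2)) (fun η => ?_) (fun η => ?_) ⟨ξ, hξ⟩⟩
  · filter_upwards [eventually_gt_atTop 0] with ν hν
    exact blockSum_rpow_mul_chebInt η.2 hν
  · have h := blockSum_isBigO η.2 (G := fun q _ => (q : ℝ) ^ (-η.1) * chebInt q) (C := 2)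
      (Eventually.of_forall fun q _ => abs_rpow_mul_chebInt_le _ q)
    refine ((Asymptotics.isBigO_refl (fun ν : ℕ => (ν : ℝ) ^ (η.1 + 1)) atTop).mul h).congr'
      EventuallyEq.rfl ?_
    filter_upwards [eventually_gt_atTop 0] with ν hν
    have hν' : (0 : ℝ) < ν := by exact_mod_cast hν
    rw [← Real.rpow_add hν', ← Real.rpow_natCast]
    congr 1; push_cast; ring

lemma exists_hasEvenExp_blockSum {ξ : ℝ} (hξ : 1 < ξ) :
    ∃ c, HasEvenExp c (fun ν : ℕ =>
      (ν : ℝ) ^ (ξ + 1) * blockSum ν (fun q s => (q : ℝ) ^ (-ξ) * (chebInt q - chebInt s))) := by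
  obtain ⟨c, hc⟩ := exists_hasEvenExp_blockSum_rpow_mul_chebInt hξ
  obtain ⟨c', hc'⟩ := (geomBound_powCoeff hξ).exists_hasEvenExp_chebSeriesSum
  refine ⟨_, (hc.sub hc').congr ?_⟩
  filter_upwards [eventually_gt_atTop 0] with ν hν
  have hν' : (0 : ℝ) < ν := by exact_mod_cast hν
  have h1 := (hasSum_blockTerm_rpow_mul hξ hν (fun s => chebInt s)).mul_left (-1)
  have h2 := (summable_blockTerm hξ hν (G := fun q _ => (q : ℝ) ^ (-ξ) * chebInt q)
    fun q s _ _ => abs_rpow_mul_chebInt_le _ q).hasSum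
  have h3 : blockSum ν (fun q s => (q : ℝ) ^ (-ξ) * (chebInt q - chebInt s)) =
      blockSum ν (fun q _ => (q : ℝ) ^ (-ξ) * chebInt q) + -1 *
      ((ν : ℝ) ^ (-ξ) * trapSum ν (fun s => chebInt s * evenSeries (powCoeff ξ) ((s : ℝ) / ν))) := by
    refine ((h2.add h1).congr_fun fun p => ?_).tsum_eq
    rw [← blockTerm_const_mul, ← blockTerm_add]
    exact blockTerm_congr (fun q s _ _ => by ring) p
  have e : (ν : ℝ) ^ (ξ + 1) * (ν : ℝ) ^ (-ξ) = ν := by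
    rw [← Real.rpow_add hν', show ξ + 1 + -ξ = 1 by ring, Real.rpow_one]
  rw [h3, chebSeriesSum]
  linear_combination -trapSum ν (fun s => chebInt s * evenSeries (powCoeff ξ) ((s : ℝ) / ν)) * e

lemma sin_half_mul_trapSum_cos {N : ℕ} (hN : 0 < N) (θ : ℝ) :
    sin (θ / 2) * trapSum N (fun j => cos (j * θ)) = cos (θ / 2) * sin (N * θ) / 2 := by
  have key : ∀ n : ℕ, sin (θ / 2) * (∑ s ∈ range n, cos (s * θ) + cos (n * θ) / 2 - 1 / 2) =
      cos (θ / 2) * sin (n * θ) / 2 := by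
    intro n
    induction n with
    | zero => simp
    | succ n ih =>
      have e : ∀ x : ℝ, sin (θ / 2) * (cos x + cos (x + θ)) =
          cos (θ / 2) * (sin (x + θ) - sin x) := fun x => by
        obtain ⟨y, rfl⟩ : ∃ y, x = y - θ / 2 := ⟨x + θ / 2, by ring⟩
        rw [show y - θ / 2 + θ = y + θ / 2 by ring, cos_sub, cos_add, sin_add, sin_sub]; ring
      have h := e (n * θ)
      rw [sum_range_succ]
      push_cast
      rw [add_mul, one_mul]
      linear_combination ih + h / 2
  rw [trapSum_eq hN, ← key N]
  simp

lemma trapSum_cos {N : ℕ} (hN : 0 < N) (c : ℤ) :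
    trapSum N (fun j => cos (c * (j * π / N))) = if (2 * N : ℤ) ∣ c then (N : ℝ) else 0 := by
  have hN' : (N : ℝ) ≠ 0 := by positivity
  split_ifs with h
  · obtain ⟨m, rfl⟩ := h
    refine (trapSum_congr fun j _ => ?_).trans (trapSum_one hN)
    rw [← Real.cos_int_mul_two_pi (m * j)]
    congr 1
    push_cast
    field_simp
  · have hs : sin (c * π / N / 2) ≠ 0 := by
      intro h0
      obtain ⟨m, hm⟩ := Real.sin_eq_zero_iff.mp h0
      refine h ⟨m, ?_⟩
      have hc : (c : ℝ) = 2 * N * m := by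
        field_simp at hm
        linarith
      exact_mod_cast hc
    have h1 := sin_half_mul_trapSum_cos hN (c * π / N)
    rw [show (N : ℝ) * (c * π / N) = c * π by field_simp, Real.sin_int_mul_pi, mul_zero,
      zero_div] at h1
    rw [← (mul_eq_zero.mp h1).resolve_left hs]
    exact trapSum_congr fun j _ => by congr 1; ring

/-- The number of signs `±` with `2 ν ∣ q ± s`. -/
noncomputable def aliasCount (ν q s : ℕ) : ℝ :=
  (if (2 * ν : ℤ) ∣ q + s then 1 else 0) + (if (2 * ν : ℤ) ∣ q - s then 1 else 0)

lemma two_mul_ccWeight_sum_cos {N : ℕ} (hN : 0 < N) (k m : ℕ) :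
    trapSum N (fun j => 2 * (cos (2 * j * k * π / N) * cos (m * (j * π / N)))) =
      (if (2 * N : ℤ) ∣ m + 2 * k then (N : ℝ) else 0) +
      (if (2 * N : ℤ) ∣ m - 2 * k then (N : ℝ) else 0) := by
  rw [← trapSum_cos hN, ← trapSum_cos hN, ← trapSum_add]
  refine trapSum_congr fun j _ => ?_
  push_cast
  rw [show ((m : ℝ) + 2 * k) * (j * π / N) = m * (j * π / N) + 2 * j * k * π / N by ring,
    show ((m : ℝ) - 2 * k) * (j * π / N) = m * (j * π / N) - 2 * j * k * π / N by ring,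
    cos_add, cos_sub]
  ring

lemma ccDelta_two_mul (ν k : ℕ) : ccDelta (2 * ν) (2 * k) = ccDelta ν k := by
  unfold ccDelta
  congr 1
  simp

/-- The Clenshaw–Curtis rule applied to `cos (m ·)`. -/
lemma sum_ccWeight_mul_cos {ν : ℕ} (hν : 0 < ν) (m : ℕ) :
    ∑ j ∈ range (2 * ν + 1), ccWeight (2 * ν) j * cos (m * (j * π / (2 * ν : ℕ))) =
      trapSum ν (fun k => chebInt k * ((if (2 * (2 * ν : ℕ) : ℤ) ∣ m + 2 * k then 1 else 0) +
        (if (2 * (2 * ν : ℕ) : ℤ) ∣ m - 2 * k then 1 else 0))) := by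
  have hN : 0 < 2 * ν := by omega
  have hN' : ((2 * ν : ℕ) : ℝ) ≠ 0 := by positivity
  simp only [ccWeight, Nat.mul_div_cancel_left ν two_pos, mul_sum, sum_mul]
  rw [sum_comm, trapSum]
  refine sum_congr rfl fun k _ => ?_
  have h := two_mul_ccWeight_sum_cos hN k m
  rw [trapSum] at h
  have h' : (if (2 * (2 * ν : ℕ) : ℤ) ∣ m + 2 * k then (1 : ℝ) else 0) +
      (if (2 * (2 * ν : ℕ) : ℤ) ∣ m - 2 * k then 1 else 0) = ((2 * ν : ℕ) : ℝ)⁻¹ *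
      ((if (2 * (2 * ν : ℕ) : ℤ) ∣ m + 2 * k then ((2 * ν : ℕ) : ℝ) else 0) +
      (if (2 * (2 * ν : ℕ) : ℤ) ∣ m - 2 * k then ((2 * ν : ℕ) : ℝ) else 0)) := by
    split_ifs <;> field_simp <;> ring
  rw [h', ← h, mul_sum, mul_sum, mul_sum]
  refine sum_congr rfl fun j _ => ?_
  rw [ccDelta_two_mul, chebInt]
  ring

lemma sum_ccWeight_mul_cos_two_mul {ν : ℕ} (hν : 0 < ν) (q : ℕ) :
    ∑ j ∈ range (2 * ν + 1), ccWeight (2 * ν) j * cos ((2 * q : ℕ) * (j * π / (2 * ν : ℕ))) =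
      trapSum ν (fun k => chebInt k * aliasCount ν q k) := by
  rw [sum_ccWeight_mul_cos hν]
  refine trapSum_congr fun k _ => ?_
  have e1 : ((2 * (2 * ν : ℕ) : ℤ) ∣ (2 * q : ℕ) + 2 * k) ↔ (2 * ν : ℤ) ∣ q + k := by
    push_cast
    rw [← mul_add]
    exact mul_dvd_mul_iff_left two_ne_zero
  have e2 : ((2 * (2 * ν : ℕ) : ℤ) ∣ (2 * q : ℕ) - 2 * k) ↔ (2 * ν : ℤ) ∣ q - k := by
    push_cast
    rw [← mul_sub]
    exact mul_dvd_mul_iff_left two_ne_zero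
  rw [aliasCount]
  simp only [e1, e2]

lemma sum_ccWeight_mul_cos_odd {ν : ℕ} (hν : 0 < ν) {m : ℕ} (hm : Odd m) :
    ∑ j ∈ range (2 * ν + 1), ccWeight (2 * ν) j * cos (m * (j * π / (2 * ν : ℕ))) = 0 := by
  rw [sum_ccWeight_mul_cos hν, trapSum]
  refine sum_eq_zero fun k _ => ?_
  obtain ⟨l, rfl⟩ := hm
  rw [if_neg, if_neg]
  · simp
  · rintro ⟨c, hc⟩
    rw [mul_assoc] at hc
    push_cast at hc
    omega
  · rintro ⟨c, hc⟩
    rw [mul_assoc] at hc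
    push_cast at hc
    omega

lemma trapSum_aliasCount {ν : ℕ} (hν : 0 < ν) (q : ℕ) :
    trapSum ν (fun s => aliasCount ν q s) = 1 := by
  have hdm : q % (2 * ν) + 2 * ν * (q / (2 * ν)) = q := Nat.mod_add_div _ _
  have hlt : q % (2 * ν) < 2 * ν := Nat.mod_lt _ (by omega)
  set r := q % (2 * ν)
  set p := q / (2 * ν)
  have h1 : ∀ s : ℕ, s ≤ ν → ((2 * ν : ℤ) ∣ q + s ↔ r + s = 0 ∨ r + s = 2 * ν) := by
    intro s hs
    rw [← hdm, show ((r + 2 * ν * p : ℕ) : ℤ) + s = (r + s : ℕ) + 2 * ν * p by push_cast; ring,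
      Int.dvd_add_left (Dvd.intro _ rfl), show (2 * ν : ℤ) = (2 * ν : ℕ) by push_cast; ring,
      Int.natCast_dvd_natCast]
    constructor
    · rintro ⟨c, hc⟩
      rcases c with _ | _ | c
      · omega
      · omega
      · have : 2 * ν * (c + 1 + 1) = 2 * (ν * c) + 4 * ν := by ring
        omega
    · rintro (h | h) <;> rw [h]
      exact dvd_zero _
  have h2 : ∀ s : ℕ, s ≤ ν → ((2 * ν : ℤ) ∣ q - s ↔ r = s) := by
    intro s hs
    rw [← hdm, show ((r + 2 * ν * p : ℕ) : ℤ) - s = (r - s : ℤ) + 2 * ν * p by push_cast; ring,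
      Int.dvd_add_left (Dvd.intro _ rfl)]
    constructor
    · rintro h
      have := Int.eq_zero_of_abs_lt_dvd h (by rw [abs_lt]; omega)
      omega
    · rintro rfl; simp
  rw [trapSum, sum_eq_single (min r (2 * ν - r))]
  · rw [aliasCount]
    have hle : min r (2 * ν - r) ≤ ν := by omega
    simp only [h1 _ hle, h2 _ hle, ccDelta]
    rcases Nat.eq_zero_or_pos r with h0 | h0
    · simp only [h0]
      norm_num
    rcases lt_trichotomy r ν with h | h | h
    · rw [min_eq_left (by omega), if_neg (by omega), if_neg (by omega), if_pos rfl]; norm_num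
    · rw [min_eq_left (by omega), if_pos (by omega), if_pos (by omega), if_pos rfl]; norm_num
    · rw [min_eq_right (by omega), if_neg (by omega), if_pos (by omega), if_neg (by omega)]
      norm_num
  · intro s hs hne
    have hs' : s ≤ ν := by have := mem_range.mp hs; omega
    rw [aliasCount, if_neg, if_neg]
    · simp
    · rw [h2 s hs']; omega
    · rw [h1 s hs']; omega
  · intro h
    exact absurd (mem_range.mpr (by omega)) h

lemma hasSum_mul_dvd_add {ν : ℕ} (hν : 0 < ν) {g : ℕ → ℝ} (hg : Summable g) {s : ℕ} (hs : s ≤ ν)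
    (hgs : g s = 0) :
    HasSum (fun q : ℕ => g q * if (2 * ν : ℤ) ∣ q + s then 1 else 0)
      (∑' p, g (2 * ν * (p + 1) - s)) := by
  have hle : ∀ p, s ≤ 2 * ν * (p + 1) := fun p => by
    have : 2 * ν * (p + 1) = 2 * (ν * p) + 2 * ν := by ring
    omega
  have hinj : Function.Injective (fun p : ℕ => 2 * ν * (p + 1) - s) := fun p p' h => by
    have h1 := hle p
    have h2 := hle p'
    simp only [] at h
    have : 2 * ν * (p + 1) = 2 * ν * (p' + 1) := by omega
    have := Nat.eq_of_mul_eq_mul_left (by omega) this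
    omega
  refine (hinj.hasSum_iff fun q hq => ?_).mp ?_
  · split_ifs with h
    · obtain ⟨c, hc⟩ := h
      rcases lt_trichotomy c 0 with h0 | rfl | h0
      · have : (2 * ν : ℤ) * c < 0 := mul_neg_of_pos_of_neg (by omega) h0
        omega
      · obtain rfl : q = s := by omega
        rw [hgs, zero_mul]
      · refine absurd ⟨(c - 1).toNat, ?_⟩ hq
        have hc' : (((c - 1).toNat : ℕ) : ℤ) = c - 1 := Int.toNat_of_nonneg (by omega)
        have h3 := hle (c - 1).toNat
        zify [h3]
        rw [hc']
        linarith
    · rw [mul_zero]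
  · have e : ∀ p, ((2 * ν * (p + 1) - s : ℕ) : ℤ) + s = 2 * ν * (p + 1) := fun p => by
      have h3 := hle p
      zify [h3]
      ring
    refine (hg.comp_injective hinj).hasSum.congr_fun fun p => ?_
    simp only [Function.comp]
    rw [if_pos (by rw [e]; exact Dvd.intro _ rfl), mul_one]

lemma hasSum_mul_dvd_sub {ν : ℕ} (hν : 0 < ν) {g : ℕ → ℝ} (hg : Summable g) {s : ℕ} (hs : s ≤ ν)
    (hgs : g s = 0) :
    HasSum (fun q : ℕ => g q * if (2 * ν : ℤ) ∣ q - s then 1 else 0)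
      (∑' p, g (2 * ν * (p + 1) + s)) := by
  have hinj : Function.Injective (fun p : ℕ => 2 * ν * (p + 1) + s) := fun p p' h => by
    simp only [] at h
    have : 2 * ν * (p + 1) = 2 * ν * (p' + 1) := by omega
    have := Nat.eq_of_mul_eq_mul_left (by omega) this
    omega
  refine (hinj.hasSum_iff fun q hq => ?_).mp ?_
  · split_ifs with h
    · obtain ⟨c, hc⟩ := h
      rcases lt_trichotomy c 0 with h0 | rfl | h0
      · have : (2 * ν : ℤ) * c ≤ 2 * ν * (-1) := by
          gcongr; omega
        omega
      · obtain rfl : q = s := by omega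
        rw [hgs, zero_mul]
      · refine absurd ⟨(c - 1).toNat, ?_⟩ hq
        have hc' : (((c - 1).toNat : ℕ) : ℤ) = c - 1 := Int.toNat_of_nonneg (by omega)
        zify
        rw [hc']
        linarith
    · rw [mul_zero]
  · have e : ∀ p, ((2 * ν * (p + 1) + s : ℕ) : ℤ) - s = 2 * ν * (p + 1) := fun p => by
      zify
      ring
    refine (hg.comp_injective hinj).hasSum.congr_fun fun p => ?_
    simp only [Function.comp]
    rw [if_pos (by rw [e]; exact Dvd.intro _ rfl), mul_one]

/-- Regrouping a sum over all indices according to their residues modulo `2 ν`. -/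
lemma hasSum_trapSum_aliasCount {ν : ℕ} (hν : 0 < ν) {H : ℕ → ℕ → ℝ}
    (hH : ∀ s, Summable fun q => H q s) (hdiag : ∀ s, H s s = 0) :
    HasSum (fun q => trapSum ν (fun s => H q s * aliasCount ν q s)) (blockSum ν H) := by
  have hsum : ∀ s, s ≤ ν → Summable (fun p => H (2 * ν * (p + 1) + s) s) ∧
      Summable (fun p => H (2 * ν * (p + 1) - s) s) := by
    intro s hs
    constructor
    · refine (hH s).comp_injective (i := fun p => 2 * ν * (p + 1) + s) fun p p' h => ?_
      simp only [] at h
      have : 2 * ν * (p + 1) = 2 * ν * (p' + 1) := by omega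
      have := Nat.eq_of_mul_eq_mul_left (by omega) this
      omega
    · refine (hH s).comp_injective (i := fun p => 2 * ν * (p + 1) - s) fun p p' h => ?_
      simp only [] at h
      have e1 : 2 * ν * (p + 1) = 2 * (ν * p) + 2 * ν := by ring
      have e2 : 2 * ν * (p' + 1) = 2 * (ν * p') + 2 * ν := by ring
      have : 2 * ν * (p + 1) = 2 * ν * (p' + 1) := by omega
      have := Nat.eq_of_mul_eq_mul_left (by omega) this
      omega
  have h1 : HasSum (fun q => trapSum ν (fun s => H q s * aliasCount ν q s))
      (trapSum ν fun s => ∑' p, H (2 * ν * (p + 1) - s) s + ∑' p, H (2 * ν * (p + 1) + s) s) := by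
    refine hasSum_sum fun s hs => ?_
    have hs' : s ≤ ν := by have := mem_range.mp hs; omega
    refine HasSum.mul_left _ ?_
    refine ((hasSum_mul_dvd_add hν (hH s) hs' (hdiag s)).add
      (hasSum_mul_dvd_sub hν (hH s) hs' (hdiag s))).congr_fun fun q => ?_
    simp only [aliasCount, mul_add]
  have h2 : HasSum (blockTerm ν H)
      (trapSum ν fun s => ∑' p, H (2 * ν * (p + 1) - s) s + ∑' p, H (2 * ν * (p + 1) + s) s) := by
    refine hasSum_sum fun s hs => ?_
    have hs' : s ≤ ν := by have := mem_range.mp hs; omega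
    refine HasSum.mul_left _ ?_
    refine ((hsum s hs').2.hasSum.add (hsum s hs').1.hasSum).congr_fun fun p => ?_
    exact add_comm _ _
  rw [blockSum, h2.tsum_eq]
  exact h1

lemma continuous_comp_cos {f : ℝ → ℝ} (hf : ContinuousOn f (Set.Icc (-1) 1)) :
    Continuous fun t : ℝ => f (cos t) :=
  hf.comp_continuous continuous_cos fun t => ⟨neg_one_le_cos t, cos_le_one t⟩

lemma integral_comp_cos_mul_cos_symm {f : ℝ → ℝ} (hf : ContinuousOn f (Set.Icc (-1) 1)) (m : ℤ) :
    ∫ t in (-π)..π, f (cos t) * cos (m * t) = π * chebCoeff f m.natAbs := by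
  have hc : Continuous fun t : ℝ => f (cos t) * cos (m * t) :=
    (continuous_comp_cos hf).mul (by fun_prop)
  have e : ∫ t in (0 : ℝ)..π, f (cos t) * cos (m * t) = π / 2 * chebCoeff f m.natAbs := by
    rw [chebCoeff, ← mul_assoc, show π / 2 * (2 / π) = 1 by field_simp, one_mul]
    congr 1
    ext t
    rw [← cos_abs (m * t), abs_mul, Nat.cast_natAbs, Int.cast_abs, ← cos_abs (|(m : ℝ)| * t), abs_mul,
      abs_abs]
  have e' : ∫ t in (-π)..0, f (cos t) * cos (m * t) = ∫ t in (0 : ℝ)..π, f (cos t) * cos (m * t) := by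
    have := intervalIntegral.integral_comp_neg (a := 0) (b := π) (fun t => f (cos t) * cos (m * t))
    rw [neg_zero] at this
    rw [← this]
    simp
  rw [← intervalIntegral.integral_add_adjacent_intervals (b := 0) (hc.intervalIntegrable _ _)
    (hc.intervalIntegrable _ _), e', e]
  ring

lemma integral_comp_cos_mul_sin_symm {f : ℝ → ℝ} (m : ℤ) :
    ∫ t in (-π)..π, f (cos t) * sin (m * t) = 0 := by
  have := intervalIntegral.integral_comp_neg (a := -π) (b := π) (fun t => f (cos t) * sin (m * t))
  simp only [cos_neg, mul_neg, sin_neg, intervalIntegral.integral_neg, neg_neg] at this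
  linarith

instance : Fact (0 < 2 * π) := ⟨two_pi_pos⟩

/-- The continuous function `t ↦ f (cos t)` on the circle. -/
noncomputable def circleLift {f : ℝ → ℝ} (hf : ContinuousOn f (Set.Icc (-1) 1)) :
    C(AddCircle (2 * π), ℂ) where
  toFun x := (f (Real.Angle.cos x) : ℂ)
  continuous_toFun := Complex.continuous_ofReal.comp <| hf.comp_continuous Real.Angle.continuous_cos
    fun x => by
      induction x using Real.Angle.induction_on with
      | h t => rw [Real.Angle.cos_coe]; exact ⟨neg_one_le_cos t, cos_le_one t⟩

lemma circleLift_coe {f : ℝ → ℝ} (hf : ContinuousOn f (Set.Icc (-1) 1)) (t : ℝ) :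
    circleLift hf (t : AddCircle (2 * π)) = (f (cos t) : ℂ) := rfl

lemma fourier_two_pi_apply (m : ℤ) (t : ℝ) :
    fourier m (t : AddCircle (2 * π)) = (cos (m * t) : ℂ) + (sin (m * t) : ℂ) * Complex.I := by
  rw [fourier_coe_apply, Complex.ofReal_cos, Complex.ofReal_sin, ← Complex.exp_mul_I]
  congr 1
  push_cast
  field_simp

lemma fourierCoeff_circleLift {f : ℝ → ℝ} (hf : ContinuousOn f (Set.Icc (-1) 1)) (m : ℤ) :
    fourierCoeff (circleLift hf) m = (chebCoeff f m.natAbs / 2 : ℝ) := by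
  have hc : Continuous fun t : ℝ => f (cos t) * cos (m * t) :=
    (continuous_comp_cos hf).mul (by fun_prop)
  have hs : Continuous fun t : ℝ => f (cos t) * sin (m * t) :=
    (continuous_comp_cos hf).mul (by fun_prop)
  rw [fourierCoeff_eq_intervalIntegral _ _ (-π), show -π + 2 * π = π by ring]
  have e : ∀ t : ℝ, fourier (-m) (t : AddCircle (2 * π)) • circleLift hf t =
      ((f (cos t) * cos (m * t) : ℝ) : ℂ) - ((f (cos t) * sin (m * t) : ℝ) : ℂ) * Complex.I := by
    intro t
    rw [fourier_two_pi_apply, circleLift_coe, smul_eq_mul]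
    push_cast
    rw [neg_mul, Complex.cos_neg, Complex.sin_neg]
    ring
  simp only [e]
  rw [intervalIntegral.integral_sub, intervalIntegral.integral_mul_const,
    intervalIntegral.integral_ofReal, intervalIntegral.integral_ofReal,
    integral_comp_cos_mul_cos_symm hf, integral_comp_cos_mul_sin_symm]
  · simp only [Complex.ofReal_zero, zero_mul, sub_zero, Complex.real_smul]
    norm_cast
    field_simp
  · exact (Complex.continuous_ofReal.comp hc).intervalIntegrable _ _
  · exact ((Complex.continuous_ofReal.comp hs).mul continuous_const).intervalIntegrable _ _

/-- The Chebyshev series converges to the function when its coefficients are summable. -/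
lemma hasSum_chebCoeff_mul_cos {f : ℝ → ℝ} (hf : ContinuousOn f (Set.Icc (-1) 1))
    (ha : Summable (chebCoeff f)) (t : ℝ) :
    HasSum (fun m : ℕ => chebCoeff f m * cos (m * t)) (f (cos t) + chebCoeff f 0 / 2) := by
  have hs : Summable (fourierCoeff (circleLift hf)) := by
    refine Summable.of_nat_of_neg ?_ ?_ <;>
    · simp only [fourierCoeff_circleLift, Int.natAbs_neg, Int.natAbs_natCast]
      exact Complex.summable_ofReal.mpr (ha.div_const 2)
  have h := (has_pointwise_sum_fourier_series_of_summable hs (t : AddCircle (2 * π))).nat_add_neg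
  simp only [fourierCoeff_circleLift, Int.natAbs_neg, Int.natAbs_natCast, fourier_two_pi_apply,
    circleLift_coe, smul_eq_mul] at h
  rw [← Complex.hasSum_ofReal]
  convert h using 1
  · ext m
    push_cast
    rw [neg_mul, Complex.cos_neg, Complex.sin_neg]
    ring
  · push_cast
    simp

lemma integral_eq_integral_cos_mul_sin {f : ℝ → ℝ} (hf : ContinuousOn f (Set.Icc (-1) 1)) :
    ∫ x in (-1 : ℝ)..1, f x = ∫ t in (0 : ℝ)..π, f (cos t) * sin t := by
  have h := intervalIntegral.integral_comp_mul_deriv'' (a := 0) (b := π) (f := cos)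
    (f' := fun t => -sin t) (g := f) continuous_cos.continuousOn
    (fun t _ => (hasDerivAt_cos t).hasDerivWithinAt) (by fun_prop)
    (hf.mono (by rintro _ ⟨t, _, rfl⟩; exact ⟨neg_one_le_cos t, cos_le_one t⟩))
  simp only [Function.comp, mul_neg, intervalIntegral.integral_neg, cos_zero, cos_pi] at h
  rw [intervalIntegral.integral_symm, ← h, neg_neg]

lemma integral_cos_mul_sin_even (q : ℕ) :
    ∫ t in (0 : ℝ)..π, cos ((2 * q : ℕ) * t) * sin t = chebInt q := by
  have hq := one_sub_four_mul_sq_ne_zero q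
  have hd : ∀ t : ℝ, HasDerivAt (fun t : ℝ => -(cos ((2 * q : ℕ) * t) * cos t +
      (2 * q : ℕ) * (sin ((2 * q : ℕ) * t) * sin t)) / (1 - 4 * (q : ℝ) ^ 2))
      (cos ((2 * q : ℕ) * t) * sin t) t := by
    intro t
    have hm : HasDerivAt (fun t : ℝ => ((2 * q : ℕ) : ℝ) * t) ((2 * q : ℕ) : ℝ) t := by
      simpa using (hasDerivAt_id t).const_mul ((2 * q : ℕ) : ℝ)
    have h := ((((hm.cos).mul (hasDerivAt_cos t)).add
      (((hm.sin).mul (hasDerivAt_sin t)).const_mul ((2 * q : ℕ) : ℝ))).neg).div_const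
      (1 - 4 * (q : ℝ) ^ 2)
    refine h.congr_deriv ?_
    rw [div_eq_iff hq]
    push_cast
    ring
  rw [intervalIntegral.integral_eq_sub_of_hasDerivAt (fun t _ => hd t)
    (Continuous.intervalIntegrable (by fun_prop) _ _)]
  have e1 : cos ((2 * q : ℕ) * π) = 1 := by
    rw [Real.cos_nat_mul_pi, (even_two_mul q).neg_one_pow]
  rw [e1]
  simp [chebInt]
  field_simp
  ring

lemma integral_cos_mul_sin_odd {m : ℕ} (hm : Odd m) :
    ∫ t in (0 : ℝ)..π, cos (m * t) * sin t = 0 := by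
  have h := intervalIntegral.integral_comp_sub_left (a := 0) (b := π) (fun t => cos (m * t) * sin t) π
  simp only [sub_self, sub_zero, sin_pi_sub] at h
  have e : ∀ t : ℝ, cos (m * (π - t)) = -cos (m * t) := fun t => by
    rw [mul_sub, cos_sub, Real.cos_nat_mul_pi, Real.sin_nat_mul_pi, hm.neg_one_pow]; ring
  simp only [e, neg_mul, intervalIntegral.integral_neg] at h
  linarith

lemma hasSum_chebCoeff_mul_integral {f : ℝ → ℝ} (hf : ContinuousOn f (Set.Icc (-1) 1))
    (ha : Summable (chebCoeff f)) :
    HasSum (fun m : ℕ => chebCoeff f m * ∫ t in (0 : ℝ)..π, cos (m * t) * sin t)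
      ((∫ x in (-1 : ℝ)..1, f x) + chebCoeff f 0) := by
  have h := intervalIntegral.hasSum_integral_of_dominated_convergence (a := 0) (b := π)
    (μ := MeasureTheory.volume) (F := fun (m : ℕ) t => chebCoeff f m * cos (m * t) * sin t)
    (f := fun t => (f (cos t) + chebCoeff f 0 / 2) * sin t)
    (fun m _ => |chebCoeff f m|)
    (fun m => Continuous.aestronglyMeasurable (by fun_prop))
    (fun m => Eventually.of_forall fun t _ => by
      rw [Real.norm_eq_abs, abs_mul, abs_mul]
      calc _ ≤ |chebCoeff f m| * 1 * 1 := by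
            gcongr
            · exact abs_cos_le_one _
            · exact abs_sin_le_one _
        _ = _ := by ring)
    (Eventually.of_forall fun t _ => ha.abs)
    (intervalIntegrable_const)
    (Eventually.of_forall fun t _ => (hasSum_chebCoeff_mul_cos hf ha t).mul_right _)
  simp only [mul_assoc, intervalIntegral.integral_const_mul] at h
  have e : (∫ x in (-1 : ℝ)..1, f x) + chebCoeff f 0 =
      ∫ t in (0 : ℝ)..π, (f (cos t) + chebCoeff f 0 / 2) * sin t := by
    simp only [add_mul]
    rw [intervalIntegral.integral_add, intervalIntegral.integral_const_mul, integral_sin,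
      integral_eq_integral_cos_mul_sin hf]
    · simp
      ring
    · exact ((continuous_comp_cos hf).mul continuous_sin).intervalIntegrable _ _
    · exact Continuous.intervalIntegrable (by fun_prop) _ _
  rw [e]
  exact h

lemma hasSum_chebCoeff_mul_ccWeight {f : ℝ → ℝ} (hf : ContinuousOn f (Set.Icc (-1) 1))
    (ha : Summable (chebCoeff f)) (n : ℕ) :
    HasSum (fun m : ℕ => chebCoeff f m *
      ∑ j ∈ range (n + 1), ccWeight n j * cos (m * (j * π / n)))
      (ccQuad f n + chebCoeff f 0 / 2 * ∑ j ∈ range (n + 1), ccWeight n j) := by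
  have h : HasSum (fun m : ℕ => ∑ j ∈ range (n + 1),
      ccWeight n j * (chebCoeff f m * cos (m * (j * π / n))))
      (∑ j ∈ range (n + 1), ccWeight n j * (f (cos (j * π / n)) + chebCoeff f 0 / 2)) :=
    hasSum_sum fun j _ => (hasSum_chebCoeff_mul_cos hf ha _).mul_left _
  have e : ccQuad f n + chebCoeff f 0 / 2 * ∑ j ∈ range (n + 1), ccWeight n j =
      ∑ j ∈ range (n + 1), ccWeight n j * (f (cos (j * π / n)) + chebCoeff f 0 / 2) := by
    rw [ccQuad, mul_sum, ← sum_add_distrib]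
    exact sum_congr rfl fun j _ => by ring
  rw [e]
  refine h.congr_fun fun m => ?_
  rw [mul_sum]
  exact sum_congr rfl fun j _ => by ring

lemma abs_chebInt_sub_le (q s : ℕ) : |chebInt q - chebInt s| ≤ 4 := by
  have := abs_sub (chebInt q) (chebInt s)
  linarith [abs_chebInt_le q, abs_chebInt_le s]

/-- The aliasing formula for the quadrature error with an even number of panels. -/
lemma ccError_two_mul {f : ℝ → ℝ} (hf : ContinuousOn f (Set.Icc (-1) 1))
    (ha : Summable (chebCoeff f)) {ν : ℕ} (hν : 0 < ν) :
    ccError f (2 * ν) =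
      blockSum ν (fun q s => chebCoeff f (2 * q) * (chebInt q - chebInt s)) := by
  have h1 := (hasSum_chebCoeff_mul_integral hf ha).sub
    (hasSum_chebCoeff_mul_ccWeight hf ha (2 * ν))
  have hw : ∑ j ∈ range (2 * ν + 1), ccWeight (2 * ν) j = 2 := by
    have h := sum_ccWeight_mul_cos_two_mul hν 0
    simp only [mul_zero, Nat.cast_zero, zero_mul, cos_zero, mul_one] at h
    rw [h]
    have h0 : trapSum ν (fun k => chebInt k * aliasCount ν 0 k) =
        trapSum ν (fun k => 2 * aliasCount ν 0 k) := by
      refine trapSum_congr fun k hk => ?_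
      rcases Nat.eq_zero_or_pos k with rfl | hk0
      · simp [chebInt]
      · rw [aliasCount, if_neg, if_neg]
        · simp
        · rintro ⟨c, hc⟩
          have := Int.eq_zero_of_abs_lt_dvd (Dvd.intro c hc.symm) (by rw [abs_lt]; omega)
          omega
        · rintro ⟨c, hc⟩
          have := Int.eq_zero_of_abs_lt_dvd (Dvd.intro c hc.symm) (by rw [abs_lt]; omega)
          omega
    rw [h0, trapSum_const_mul, trapSum_aliasCount hν, mul_one]
  have e : (∫ x in (-1 : ℝ)..1, f x) + chebCoeff f 0 - (ccQuad f (2 * ν) + chebCoeff f 0 / 2 *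
      ∑ j ∈ range (2 * ν + 1), ccWeight (2 * ν) j) = ccError f (2 * ν) := by
    rw [hw, ccError]; ring
  rw [e] at h1
  have hinj : Function.Injective (fun q : ℕ => 2 * q) := fun i j h => by simpa using h
  have h2 := (hinj.hasSum_iff (fun m hm => ?_)).mpr h1
  · have hb : Summable fun q => chebCoeff f (2 * q) := ha.comp_injective hinj
    have h3 := hasSum_trapSum_aliasCount hν
      (H := fun q s => chebCoeff f (2 * q) * (chebInt q - chebInt s))
      (fun s => Summable.of_norm_bounded (hb.abs.mul_right 4) fun q => by
        rw [Real.norm_eq_abs, abs_mul]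
        gcongr
        exact abs_chebInt_sub_le q s) (fun s => by simp)
    refine h2.unique (h3.congr_fun fun q => ?_)
    simp only [Function.comp]
    rw [integral_cos_mul_sin_even, sum_ccWeight_mul_cos_two_mul hν, ← mul_sub]
    have h4 : trapSum ν (fun s => chebCoeff f (2 * q) * (chebInt q - chebInt s) *
        aliasCount ν q s) = chebCoeff f (2 * q) * (chebInt q * trapSum ν (fun s => aliasCount ν q s) -
        trapSum ν (fun s => chebInt s * aliasCount ν q s)) := by
      rw [← trapSum_const_mul, ← trapSum_sub, ← trapSum_const_mul]
      exact trapSum_congr fun s _ => by ring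
    rw [h4, trapSum_aliasCount hν, mul_one]
  · have : Odd m := by
      rw [← Nat.not_even_iff_odd]
      rintro ⟨k, hk⟩
      exact hm ⟨k, by simp only []; omega⟩
    rw [integral_cos_mul_sin_odd this, sum_ccWeight_mul_cos_odd hν this]
    simp

lemma natCast_rpow_neg_isBigO {a b : ℝ} (h : b ≤ a) :
    (fun n : ℕ => (n : ℝ) ^ (-a)) =O[atTop] fun n : ℕ => (n : ℝ) ^ (-b) := by
  refine Asymptotics.IsBigO.of_bound 1 ?_
  filter_upwards [eventually_ge_atTop 1] with n hn
  have hn' : (1 : ℝ) ≤ n := by exact_mod_cast hn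
  rw [one_mul, Real.norm_of_nonneg (by positivity), Real.norm_of_nonneg (by positivity)]
  exact Real.rpow_le_rpow_of_exponent_le hn' (by linarith)

lemma natCast_rpow_neg_isLittleO {a b : ℝ} (h : b < a) :
    (fun n : ℕ => (n : ℝ) ^ (-a)) =o[atTop] fun n : ℕ => (n : ℝ) ^ (-b) := by
  have h1 : Tendsto (fun n : ℕ => (n : ℝ) ^ (-(a - b))) atTop (nhds 0) :=
    (tendsto_rpow_neg_atTop (sub_pos.mpr h)).comp tendsto_natCast_atTop_atTop
  have h2 := ((Asymptotics.isLittleO_one_iff ℝ).mpr h1).mul_isBigO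
    (Asymptotics.isBigO_refl (fun n : ℕ => (n : ℝ) ^ (-b)) atTop)
  refine h2.congr' ?_ (Eventually.of_forall fun n => one_mul _)
  filter_upwards [eventually_gt_atTop 0] with n hn
  have hn' : (0 : ℝ) < n := by exact_mod_cast hn
  rw [← Real.rpow_add hn']
  congr 1; ring

/-- The coefficient of `x ^ (-ξ k)` in the formal series `∑ μ i * x ^ (-d i)`. -/
noncomputable def mergedCoeff (μ d ξ : ℕ → ℝ) (k : ℕ) : ℝ :=
  ∑ i ∈ range (k + 1), if d i = ξ k then μ i else 0

lemma sum_sub_sum_mergedCoeff_isBigO {μ d ξ : ℕ → ℝ} (hd : StrictMono d) (hξ : StrictMono ξ)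
    (hdξ : Set.range d ⊆ Set.range ξ) (L : ℕ) :
    (fun n : ℕ => ∑ i ∈ range L, μ i * (n : ℝ) ^ (-d i) -
      ∑ k ∈ range L, mergedCoeff μ d ξ k * (n : ℝ) ^ (-ξ k)) =O[atTop]
      fun n : ℕ => (n : ℝ) ^ (-ξ L) := by
  choose α hα using fun i => hdξ ⟨i, rfl⟩
  have hαm : StrictMono α := fun i j hij => hξ.lt_iff_lt.mp (by rw [hα, hα]; exact hd hij)
  have e1 : ∀ k ∈ range L, mergedCoeff μ d ξ k = ∑ i ∈ range L, if α i = k then μ i else 0 := by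
    intro k hk
    have hk' := mem_range.mp hk
    have : ∀ i, (d i = ξ k) = (α i = k) := fun i => by
      rw [← hα]; exact propext hξ.injective.eq_iff
    simp only [mergedCoeff, this]
    refine sum_subset (range_subset_range.mpr (by omega)) fun i _ hi => if_neg ?_
    have := hαm.le_apply (x := i)
    simp only [mem_range, not_lt] at hi
    omega
  have e2 : ∀ n : ℕ, ∑ k ∈ range L, mergedCoeff μ d ξ k * (n : ℝ) ^ (-ξ k) =
      ∑ i ∈ range L, if α i < L then μ i * (n : ℝ) ^ (-d i) else 0 := by
    intro n
    rw [sum_congr rfl fun k hk => by rw [e1 k hk, sum_mul], sum_comm]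
    refine sum_congr rfl fun i _ => ?_
    simp only [ite_mul, zero_mul, sum_ite_eq, mem_range, hα]
  simp only [e2, ← sum_sub_distrib]
  refine Asymptotics.IsBigO.fun_sum fun i _ => ?_
  by_cases h : α i < L
  · simp only [if_pos h, sub_self]
    exact Asymptotics.isBigO_zero (fun n : ℕ => (n : ℝ) ^ (-ξ L)) atTop
  · simp only [if_neg h, sub_zero]
    refine (natCast_rpow_neg_isBigO ?_).const_mul_left _
    rw [← hα]
    exact hξ.monotone (not_lt.mp h)

lemma le_of_range_subset {d ξ : ℕ → ℝ} (hd : StrictMono d) (hξ : StrictMono ξ)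
    (hdξ : Set.range d ⊆ Set.range ξ) (i : ℕ) : ξ i ≤ d i := by
  choose α hα using fun i => hdξ ⟨i, rfl⟩
  have hαm : StrictMono α := fun i j hij => hξ.lt_iff_lt.mp (by rw [hα, hα]; exact hd hij)
  rw [← hα]
  exact hξ.monotone hαm.le_apply

lemma tendsto_two_mul_atTop : Tendsto (fun q : ℕ => 2 * q) atTop atTop :=
  tendsto_id.const_mul_atTop' two_pos

lemma even_subseq_isBigO {a μ γ d z ξ : ℕ → ℝ} (hd : StrictMono d) (hz : StrictMono z)
    (hξ : StrictMono ξ) (hdξ : Set.range d ⊆ Set.range ξ) (hzξ : Set.range z ⊆ Set.range ξ) {L : ℕ}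
    (ha : (fun n : ℕ => a n - ∑ k ∈ range L, μ k * (n : ℝ) ^ (-(d k)) -
          (-1 : ℝ) ^ n * ∑ k ∈ range L, γ k * (n : ℝ) ^ (-(z k)))
        =O[atTop] fun n : ℕ => (n : ℝ) ^ (-min (d L) (z L))) :
    (fun q : ℕ => a (2 * q) - ∑ k ∈ range L, (mergedCoeff μ d ξ k + mergedCoeff γ z ξ k) *
      ((2 * q : ℕ) : ℝ) ^ (-ξ k)) =O[atTop] fun q : ℕ => (q : ℝ) ^ (-ξ L) := by
  have h1 := (ha.trans (natCast_rpow_neg_isBigO (le_min (le_of_range_subset hd hξ hdξ L)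
    (le_of_range_subset hz hξ hzξ L)))).comp_tendsto tendsto_two_mul_atTop
  have h2 := (sum_sub_sum_mergedCoeff_isBigO (μ := μ) hd hξ hdξ L).comp_tendsto tendsto_two_mul_atTop
  have h3 := (sum_sub_sum_mergedCoeff_isBigO (μ := γ) hz hξ hzξ L).comp_tendsto tendsto_two_mul_atTop
  have h4 : ((fun n : ℕ => (n : ℝ) ^ (-ξ L)) ∘ fun q : ℕ => 2 * q) =O[atTop]
      fun q : ℕ => (q : ℝ) ^ (-ξ L) := by
    refine ((Asymptotics.isBigO_refl (fun q : ℕ => (q : ℝ) ^ (-ξ L)) atTop).const_mul_left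
      (2 ^ (-ξ L))).congr_left fun q => ?_
    simp only [Function.comp]
    rw [← Real.mul_rpow (by positivity) (by positivity)]
    push_cast; rfl
  refine (((h1.add h2).add h3).trans h4).congr_left fun q => ?_
  simp only [Function.comp, (even_two_mul q).neg_one_pow, add_mul, sum_add_distrib]
  ring

lemma summable_of_mixed_expansion {a μ γ d z : ℕ → ℝ} (hd : StrictMono d) (hz : StrictMono z)
    (hd0 : 1 < d 0) (hz0 : 1 < z 0)
    (ha : (fun n : ℕ => a n - ∑ k ∈ range 1, μ k * (n : ℝ) ^ (-(d k)) -
          (-1 : ℝ) ^ n * ∑ k ∈ range 1, γ k * (n : ℝ) ^ (-(z k)))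
        =O[atTop] fun n : ℕ => (n : ℝ) ^ (-min (d 1) (z 1))) : Summable a := by
  have hκ : 1 < min (d 0) (z 0) := lt_min hd0 hz0
  have h1 := ha.trans (natCast_rpow_neg_isBigO (b := min (d 0) (z 0))
    (min_le_min (hd.monotone zero_le_one) (hz.monotone zero_le_one)))
  have h2 := (natCast_rpow_neg_isBigO (min_le_left (d 0) (z 0))).const_mul_left (μ 0)
  have h3 : (fun n : ℕ => (-1 : ℝ) ^ n * (γ 0 * (n : ℝ) ^ (-z 0))) =O[atTop]
      fun n : ℕ => (n : ℝ) ^ (-min (d 0) (z 0)) := by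
    refine Asymptotics.IsBigO.trans (Asymptotics.IsBigO.of_bound 1 (Eventually.of_forall fun n => ?_))
      ((natCast_rpow_neg_isBigO (min_le_right (d 0) (z 0))).const_mul_left (γ 0))
    simp
  refine summable_of_isBigO_nat (Real.summable_nat_rpow.mpr (by linarith : -min (d 0) (z 0) < -1))
    (((h1.add h2).add h3).congr_left fun n => ?_)
  simp only [range_one, sum_singleton]
  ring

/-- The expansion coefficients of the block sum attached to `q ^ (-ξ)`. -/
noncomputable def blockCoeff (ξ : ℝ) : ℕ → ℝ :=
  if h : 1 < ξ then (exists_hasEvenExp_blockSum h).choose else 0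

lemma hasEvenExp_blockCoeff {ξ : ℝ} (hξ : 1 < ξ) :
    HasEvenExp (blockCoeff ξ) (fun ν : ℕ =>
      (ν : ℝ) ^ (ξ + 1) * blockSum ν (fun q s => (q : ℝ) ^ (-ξ) * (chebInt q - chebInt s))) := by
  rw [blockCoeff, dif_pos hξ]
  exact (exists_hasEvenExp_blockSum hξ).choose_spec

lemma blockSum_sub_sum_isBigO {ξ : ℝ} (hξ : 1 < ξ) (J : ℕ) :
    (fun ν : ℕ => blockSum ν (fun q s => ((2 * q : ℕ) : ℝ) ^ (-ξ) * (chebInt q - chebInt s)) -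
      ∑ j ∈ range J, blockCoeff ξ j * 2 ^ (2 * j + 1) *
        ((2 * ν : ℕ) : ℝ) ^ (-(ξ + 2 * (j : ℝ) + 1))) =O[atTop]
      fun ν : ℕ => (ν : ℝ) ^ (-(ξ + 2 * (J : ℝ) + 1)) := by
  have h1 := ((Asymptotics.isBigO_refl (fun ν : ℕ => (ν : ℝ) ^ (-(ξ + 1))) atTop).mul
    (hasEvenExp_blockCoeff hξ J)).const_mul_left (2 ^ (-ξ))
  have e : ∀ {ν : ℕ} (j : ℕ), 0 < ν → (ν : ℝ) ^ (-(ξ + 1)) * ((ν : ℝ)⁻¹) ^ (2 * j) =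
      (ν : ℝ) ^ (-(ξ + 2 * (j : ℝ) + 1)) := by
    intro ν j hν
    have hν' : (0 : ℝ) < ν := by exact_mod_cast hν
    rw [← Real.rpow_natCast, Real.inv_rpow hν'.le, ← Real.rpow_neg hν'.le, ← Real.rpow_add hν']
    congr 1; push_cast; ring
  refine h1.congr' ?_ ?_
  · filter_upwards [eventually_gt_atTop 0] with ν hν
    have hν' : (0 : ℝ) < ν := by exact_mod_cast hν
    have e0 : (ν : ℝ) ^ (-(ξ + 1)) * (ν : ℝ) ^ (ξ + 1) = 1 := by
      rw [← Real.rpow_add hν', neg_add_cancel, Real.rpow_zero]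
    have e1 : blockSum ν (fun q s => ((2 * q : ℕ) : ℝ) ^ (-ξ) * (chebInt q - chebInt s)) =
        2 ^ (-ξ) * blockSum ν (fun q s => (q : ℝ) ^ (-ξ) * (chebInt q - chebInt s)) := by
      rw [blockSum, blockSum, ← tsum_mul_left]
      refine tsum_congr fun p => ?_
      rw [← blockTerm_const_mul]
      refine blockTerm_congr (fun q s _ _ => ?_) p
      rw [← mul_assoc, ← Real.mul_rpow (by positivity) (by positivity)]
      push_cast; rfl
    have e2 : ∀ j ∈ range J, blockCoeff ξ j * 2 ^ (2 * j + 1) *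
        ((2 * ν : ℕ) : ℝ) ^ (-(ξ + 2 * (j : ℝ) + 1)) =
        2 ^ (-ξ) * ((ν : ℝ) ^ (-(ξ + 1)) * (blockCoeff ξ j * ((ν : ℝ)⁻¹) ^ (2 * j))) := by
      intro j _
      have e3 : (2 : ℝ) ^ (2 * j + 1) * 2 ^ (-(ξ + 2 * (j : ℝ) + 1)) = 2 ^ (-ξ) := by
        rw [← Real.rpow_natCast, ← Real.rpow_add two_pos]
        congr 1; push_cast; ring
      push_cast
      rw [Real.mul_rpow two_pos.le hν'.le, ← e j hν, ← e3]
      ring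
    rw [sum_congr rfl e2, ← mul_sum, ← mul_sum, e1]
    linear_combination 2 ^ (-ξ) *
      blockSum ν (fun q s => (q : ℝ) ^ (-ξ) * (chebInt q - chebInt s)) * e0
  · filter_upwards [eventually_gt_atTop 0] with ν hν
    exact e J hν

lemma exists_eventually_abs_mul_chebInt_sub_le {κ : ℝ} {a : ℕ → ℝ}
    (ha : a =O[atTop] fun q : ℕ => (q : ℝ) ^ (-κ)) :
    ∃ C, ∀ᶠ q : ℕ in atTop, ∀ s : ℕ, |a q * (chebInt q - chebInt s)| ≤ C * (q : ℝ) ^ (-κ) := by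
  obtain ⟨C, hC⟩ := ha.bound
  refine ⟨C * 4, ?_⟩
  filter_upwards [hC] with q hq s
  rw [Real.norm_eq_abs, Real.norm_of_nonneg (by positivity : 0 ≤ (q : ℝ) ^ (-κ))] at hq
  rw [abs_mul]
  calc _ ≤ C * (q : ℝ) ^ (-κ) * 4 := by
        gcongr
        · exact (abs_nonneg _).trans hq
        · exact abs_chebInt_sub_le q s
    _ = _ := by ring

lemma summable_blockTerm_two_mul_rpow {ξ : ℝ} (hξ : 1 < ξ) {ν : ℕ} (hν : 0 < ν) :
    Summable (blockTerm ν (fun q s => ((2 * q : ℕ) : ℝ) ^ (-ξ) * (chebInt q - chebInt s))) := by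
  refine summable_blockTerm hξ hν (C := 2 ^ (-ξ) * 4) fun q s _ _ => ?_
  push_cast
  rw [Real.mul_rpow two_pos.le (by positivity), abs_mul, abs_of_nonneg (by positivity)]
  calc _ ≤ 2 ^ (-ξ) * (q : ℝ) ^ (-ξ) * 4 := by
        gcongr
        exact abs_chebInt_sub_le q s
    _ = _ := by ring

/-- Expansion of the block sum of a sequence admitting an expansion in powers of the index. -/
lemma blockSum_sub_sum_sum_isBigO {b c ξ : ℕ → ℝ} (hξ : ∀ k, 1 < ξ k) {L : ℕ}
    (hb : (fun q : ℕ => b q - ∑ k ∈ range L, c k * ((2 * q : ℕ) : ℝ) ^ (-ξ k)) =O[atTop]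
      fun q : ℕ => (q : ℝ) ^ (-ξ L)) :
    (fun ν : ℕ => blockSum ν (fun q s => b q * (chebInt q - chebInt s)) - ∑ k ∈ range L, c k *
      blockSum ν (fun q s => ((2 * q : ℕ) : ℝ) ^ (-ξ k) * (chebInt q - chebInt s))) =O[atTop]
      fun ν : ℕ => (ν : ℝ) ^ (1 - ξ L) := by
  obtain ⟨C, hC⟩ := exists_eventually_abs_mul_chebInt_sub_le hb
  refine (blockSum_isBigO (hξ L) hC).congr' ?_ EventuallyEq.rfl
  obtain ⟨q₀, hq₀⟩ := eventually_atTop.mp hC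
  filter_upwards [eventually_ge_atTop q₀, eventually_gt_atTop 0] with ν hν hν0
  have h1 := (summable_blockTerm (hξ L) hν0 fun q s hq _ => hq₀ q (hν.trans hq) s).hasSum
  have h2 : HasSum (fun p => ∑ k ∈ range L, c k * blockTerm ν (fun q s =>
      ((2 * q : ℕ) : ℝ) ^ (-ξ k) * (chebInt q - chebInt s)) p) (∑ k ∈ range L, c k *
      blockSum ν (fun q s => ((2 * q : ℕ) : ℝ) ^ (-ξ k) * (chebInt q - chebInt s))) :=
    hasSum_sum fun k _ => (summable_blockTerm_two_mul_rpow (hξ k) hν0).hasSum.mul_left _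
  rw [eq_sub_iff_add_eq]
  refine (((h1.add h2).congr_fun fun p => ?_).tsum_eq).symm
  have h3 : ∀ S : Finset ℕ, ∑ k ∈ S, c k * blockTerm ν (fun q s =>
      ((2 * q : ℕ) : ℝ) ^ (-ξ k) * (chebInt q - chebInt s)) p = blockTerm ν (fun q s =>
      ∑ k ∈ S, c k * (((2 * q : ℕ) : ℝ) ^ (-ξ k) * (chebInt q - chebInt s))) p := by
    intro S
    induction S using Finset.induction_on with
    | empty => simp [blockTerm, trapSum]
    | insert k S hk ih =>
      simp only [sum_insert hk]
      rw [ih, ← blockTerm_const_mul, ← blockTerm_add]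
  rw [h3, ← blockTerm_add]
  refine blockTerm_congr (fun q s _ _ => ?_) p
  simp only [← mul_assoc, ← sum_mul]
  ring

lemma two_mul_rpow_neg_isBigO (M : ℝ) :
    (fun ν : ℕ => (ν : ℝ) ^ (-M)) =O[atTop] fun ν : ℕ => ((2 * ν : ℕ) : ℝ) ^ (-M) := by
  refine ((Asymptotics.isBigO_refl (fun ν : ℕ => ((2 * ν : ℕ) : ℝ) ^ (-M)) atTop).const_mul_left
    (2 ^ M)).congr_left fun ν => ?_
  push_cast
  rw [Real.mul_rpow two_pos.le (by positivity), ← mul_assoc, ← Real.rpow_add two_pos,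
    add_neg_cancel, Real.rpow_zero, one_mul]

lemma inf_principal_even_le : atTop ⊓ 𝓟 {n : ℕ | Even n} ≤ map (fun ν : ℕ => 2 * ν) atTop := by
  intro s hs
  obtain ⟨ν₀, h⟩ := eventually_atTop.mp (mem_map.mp hs)
  refine mem_inf_principal.mpr ?_
  filter_upwards [eventually_ge_atTop (2 * ν₀)] with n hn hn2
  obtain ⟨ν, rfl⟩ := even_iff_two_dvd.mp hn2
  exact h ν (by omega)

lemma mem_product_of_exponent_le {ξ : ℕ → ℝ} (hξ : ∀ k, 1 < ξ k) {J L : ℕ} {M : ℝ} (hJ : M < 2 * J)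
    (hL : StrictMono ξ) (hM : M + 1 < ξ L) {p : ℕ × ℕ} (hp : ξ p.2 + 2 * (p.1 : ℝ) + 1 ≤ M) :
    p ∈ range J ×ˢ range L := by
  have h1 := hξ p.2
  rw [mem_product, mem_range, mem_range]
  constructor
  · have : (p.1 : ℝ) < J := by linarith
    exact_mod_cast this
  · refine hL.lt_iff_lt.mp ?_
    have : (0 : ℝ) ≤ p.1 := by positivity
    linarith

lemma finsum_indicator_sub_sum_isLittleO {ξ : ℕ → ℝ} (hξ : ∀ k, 1 < ξ k) (hmono : StrictMono ξ)
    {J L : ℕ} {M : ℝ} (hJ : M < 2 * J) (hM : M + 1 < ξ L) (ς : ℕ → ℕ → ℝ) :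
    (fun n : ℕ => ∑ k ∈ range L, ∑ j ∈ range J, ς j k * (n : ℝ) ^ (-(ξ k + 2 * (j : ℝ) + 1)) -
      ∑ᶠ p : ℕ × ℕ, Set.indicator {q : ℕ × ℕ | ξ q.2 + 2 * (q.1 : ℝ) + 1 ≤ M}
        (fun q => ς q.1 q.2 * (n : ℝ) ^ (-(ξ q.2 + 2 * (q.1 : ℝ) + 1))) p) =o[atTop]
      fun n : ℕ => (n : ℝ) ^ (-M) := by
  have h : ∀ n : ℕ, ∑ k ∈ range L, ∑ j ∈ range J, ς j k * (n : ℝ) ^ (-(ξ k + 2 * (j : ℝ) + 1)) -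
      ∑ᶠ p : ℕ × ℕ, Set.indicator {q : ℕ × ℕ | ξ q.2 + 2 * (q.1 : ℝ) + 1 ≤ M}
        (fun q => ς q.1 q.2 * (n : ℝ) ^ (-(ξ q.2 + 2 * (q.1 : ℝ) + 1))) p =
      ∑ p ∈ range J ×ˢ range L, (ς p.1 p.2 * (n : ℝ) ^ (-(ξ p.2 + 2 * (p.1 : ℝ) + 1)) -
        Set.indicator {q : ℕ × ℕ | ξ q.2 + 2 * (q.1 : ℝ) + 1 ≤ M}
        (fun q => ς q.1 q.2 * (n : ℝ) ^ (-(ξ q.2 + 2 * (q.1 : ℝ) + 1))) p) := by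
    intro n
    rw [finsum_eq_sum_of_support_subset (s := range J ×ˢ range L), sum_sub_distrib,
      sum_product_right (f := fun p : ℕ × ℕ => ς p.1 p.2 * (n : ℝ) ^ (-(ξ p.2 + 2 * (p.1 : ℝ) + 1)))]
    intro p hp
    have hp' : p ∈ {q : ℕ × ℕ | ξ q.2 + 2 * (q.1 : ℝ) + 1 ≤ M} := Set.mem_of_indicator_ne_zero hp
    exact mem_coe.mpr (mem_product_of_exponent_le hξ hJ hmono hM hp')
  simp only [h]
  refine Asymptotics.IsLittleO.fun_sum fun p _ => ?_
  by_cases hp : ξ p.2 + 2 * (p.1 : ℝ) + 1 ≤ M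
  · have hp' : p ∈ {q : ℕ × ℕ | ξ q.2 + 2 * (q.1 : ℝ) + 1 ≤ M} := hp
    simp only [Set.indicator_of_mem hp', sub_self]
    exact Asymptotics.isLittleO_zero _ _
  · have hp' : p ∉ {q : ℕ × ℕ | ξ q.2 + 2 * (q.1 : ℝ) + 1 ≤ M} := hp
    simp only [Set.indicator_of_notMem hp', sub_zero]
    exact (natCast_rpow_neg_isLittleO (not_le.mp hp)).const_mul_left _

/-- Asymptotic error expansion of Clenshaw–Curtis quadrature for Chebyshev coefficients
with a mixed expansion `a_n ~ Σ_k μ_k n^{−d_k} + (−1)^n Σ_k γ_k n^{−ζ_k}`, where `d`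
and `z` (for `ζ`) are strictly increasing, positive, tending to `∞`, with
`d 0 > 1`, `z 0 > 1`, and `ξ` is the strictly increasing enumeration of
`range d ∪ range z`: there exist constants `ς_{j,k}` such that for every `M > 0`,
`E_n^C[f] − Σ_{(j,k): ξ_k+2j+1 ≤ M} ς_{j,k} n^{−(ξ_k+2j+1)} = o(n^{−M})` as `n → ∞`
through even values of `n`. -/
theorem ccError_asymptotic_expansion_mixed (f : ℝ → ℝ)
    (hf : ContinuousOn f (Set.Icc (-1) 1))
    (μ γ d z : ℕ → ℝ)
    (hd_pos : ∀ k, 0 < d k) (hd_mono : StrictMono d)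
    (hd_top : Tendsto d atTop atTop) (hd0 : 1 < d 0)
    (hz_pos : ∀ k, 0 < z k) (hz_mono : StrictMono z)
    (hz_top : Tendsto z atTop atTop) (hz0 : 1 < z 0)
    (hcheb : ∀ N : ℕ, 1 ≤ N →
      (fun n : ℕ => chebCoeff f n -
          ∑ k ∈ Finset.range N, μ k * (n : ℝ) ^ (-(d k)) -
          (-1 : ℝ) ^ n * ∑ k ∈ Finset.range N, γ k * (n : ℝ) ^ (-(z k)))
        =O[atTop] fun n : ℕ => (n : ℝ) ^ (-min (d N) (z N)))
    (ξ : ℕ → ℝ) (hξ_mono : StrictMono ξ)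
    (hξ_range : Set.range ξ = Set.range d ∪ Set.range z) :
    ∃ ς : ℕ → ℕ → ℝ, ∀ M : ℝ, 0 < M →
      (fun n : ℕ => ccError f n -
          ∑ᶠ p : ℕ × ℕ,
            Set.indicator {q : ℕ × ℕ | ξ q.2 + 2 * (q.1 : ℝ) + 1 ≤ M}
              (fun q => ς q.1 q.2 * (n : ℝ) ^ (-(ξ q.2 + 2 * (q.1 : ℝ) + 1))) p)
        =o[atTop ⊓ 𝓟 {n : ℕ | Even n}] fun n : ℕ => (n : ℝ) ^ (-M) := by
  have hdξ : Set.range d ⊆ Set.range ξ := hξ_range ▸ Set.subset_union_left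
  have hzξ : Set.range z ⊆ Set.range ξ := hξ_range ▸ Set.subset_union_right
  have hξ : ∀ k, 1 < ξ k := by
    intro k
    have hk : ξ k ∈ Set.range d ∪ Set.range z := hξ_range ▸ Set.mem_range_self k
    rcases hk with ⟨i, hi⟩ | ⟨i, hi⟩ <;> rw [← hi]
    · exact hd0.trans_le (hd_mono.monotone (Nat.zero_le i))
    · exact hz0.trans_le (hz_mono.monotone (Nat.zero_le i))
  have hξ_top : ∀ K : ℝ, ∃ L, 1 ≤ L ∧ K < ξ L := by
    intro K
    obtain ⟨i, hi⟩ := (hd_top.eventually_gt_atTop K).exists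
    obtain ⟨l, hl⟩ := hdξ ⟨i, rfl⟩
    exact ⟨l + 1, by omega, hi.trans (hl ▸ hξ_mono (Nat.lt_succ_self l))⟩
  set c : ℕ → ℝ := fun k => mergedCoeff μ d ξ k + mergedCoeff γ z ξ k with hc
  have ha : Summable (chebCoeff f) :=
    summable_of_mixed_expansion hd_mono hz_mono hd0 hz0 (hcheb 1 le_rfl)
  refine ⟨fun j k => c k * (blockCoeff (ξ k) j * 2 ^ (2 * j + 1)), fun M _ => ?_⟩
  obtain ⟨L, hL1, hL⟩ := hξ_top (M + 1)
  obtain ⟨J, hJ⟩ := exists_nat_gt M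
  have hJ2 : M < 2 * J := by
    have : (0 : ℝ) ≤ J := by positivity
    linarith
  refine Asymptotics.IsLittleO.mono ?_ inf_principal_even_le
  rw [Asymptotics.isLittleO_map]
  have h1 := (blockSum_sub_sum_sum_isBigO hξ (c := c)
    (even_subseq_isBigO hd_mono hz_mono hξ_mono hdξ hzξ (hcheb L hL1))).trans_isLittleO
    ((natCast_rpow_neg_isLittleO (by linarith : M < ξ L - 1)).congr_left
      fun ν => by rw [neg_sub])
  have h2 : (fun ν : ℕ => ∑ k ∈ range L, c k *
      (blockSum ν (fun q s => ((2 * q : ℕ) : ℝ) ^ (-ξ k) * (chebInt q - chebInt s)) -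
      ∑ j ∈ range J, blockCoeff (ξ k) j * 2 ^ (2 * j + 1) *
        ((2 * ν : ℕ) : ℝ) ^ (-(ξ k + 2 * (j : ℝ) + 1)))) =o[atTop]
      fun ν : ℕ => (ν : ℝ) ^ (-M) :=
    Asymptotics.IsLittleO.fun_sum fun k _ => ((blockSum_sub_sum_isBigO (hξ k) J).trans_isLittleO
      (natCast_rpow_neg_isLittleO (by linarith [hξ k]))).const_mul_left _
  have h3 := (finsum_indicator_sub_sum_isLittleO hξ hξ_mono hJ2 hL
    (fun j k => c k * (blockCoeff (ξ k) j * 2 ^ (2 * j + 1)))).comp_tendsto tendsto_two_mul_atTop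
  refine (((h1.add h2).trans_isBigO (two_mul_rpow_neg_isBigO M)).add h3).congr' ?_ EventuallyEq.rfl
  filter_upwards [eventually_gt_atTop 0] with ν hν
  simp only [Function.comp]
  rw [ccError_two_mul hf ha hν]
  simp only [mul_sub, sum_sub_distrib, mul_sum, mul_assoc]
  ring
end

section
/- For every real d > 1, Σ_{j=1}^{∞} j^{−d} Σ_{q=1}^{∞} (d)_{2q} / ((2q)! (2j)^{2q}) = 2^d ζ(d) − 2 ζ(d) − 2^{d−1}, where both series converge absolutely. -/
open Real Filter Finset

/-- The Riemann zeta function for real `d > 1`, `ζ(d) = Σ_{n=1}^∞ n^{−d}`. -/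
noncomputable def zetaReal (d : ℝ) : ℝ := ∑' n : ℕ, 1 / ((n : ℝ) + 1) ^ d

/-- The binomial series of `(1 - x)⁻ᵈ`, with coefficients written as rising factorials. -/
lemma hasSum_ascPochhammer_div_factorial_mul_pow (d : ℝ) {x : ℝ} (hx : |x| < 1) :
    HasSum (fun n : ℕ => (ascPochhammer ℝ n).eval d / (Nat.factorial n : ℝ) * x ^ n)
      (1 / (1 - x) ^ d) := by
  have h := (Real.one_div_one_sub_rpow_hasFPowerSeriesOnBall_zero d).hasSum (y := x)
    (by simpa [enorm_eq_nnnorm, ← NNReal.coe_lt_coe] using hx)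
  have hc (n : ℕ) : Ring.choose (d + n - 1) n =
      (ascPochhammer ℝ n).eval d / (Nat.factorial n : ℝ) := by
    have h1 := Ring.factorial_nsmul_multichoose_eq_ascPochhammer d n
    rw [Ring.multichoose_eq, Polynomial.ascPochhammer_smeval_eq_eval, nsmul_eq_mul] at h1
    rw [← h1]
    field_simp
  simpa [hc, mul_comm] using h

/-- The even part of the binomial series of `(1 - x)⁻ᵈ`, without its constant term. -/
lemma hasSum_ascPochhammer_even_succ (d : ℝ) {x : ℝ} (hx : |x| < 1) :
    HasSum (fun q : ℕ => (ascPochhammer ℝ (2 * (q + 1))).eval d /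
        (Nat.factorial (2 * (q + 1)) : ℝ) * x ^ (2 * (q + 1)))
      ((1 / (1 - x) ^ d + 1 / (1 + x) ^ d) / 2 - 1) := by
  have h := ((hasSum_ascPochhammer_div_factorial_mul_pow d hx).add
    (hasSum_ascPochhammer_div_factorial_mul_pow d (x := -x) (by simpa using hx))).div_const 2
  rw [sub_neg_eq_add] at h
  rw [← Function.Injective.hasSum_iff (mul_right_injective₀ (two_ne_zero' ℕ))] at h
  · have h0 := (hasSum_nat_add_iff' 1).mpr h
    convert! h0 using 1
    · ext q
      simp [pow_mul]
    · simp
  · intro n hn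
    have hn' : Odd n := by
      rw [← Nat.not_even_iff_odd]
      rintro ⟨k, rfl⟩
      exact hn ⟨k, (two_mul k)⟩
    simp [hn'.neg_pow]

lemma hasSum_zetaReal {d : ℝ} (hd : 1 < d) :
    HasSum (fun n : ℕ => 1 / ((n : ℝ) + 1) ^ d) (zetaReal d) := by
  refine Summable.hasSum ?_
  simpa using (summable_nat_add_iff 1).mpr (Real.summable_one_div_nat_rpow.mpr hd)

/-- The sum of `n⁻ᵈ` over odd `n`. -/
lemma hasSum_one_div_odd_rpow {d : ℝ} (hd : 1 < d) :
    HasSum (fun n : ℕ => 1 / (2 * (n : ℝ) + 1) ^ d) ((1 - 1 / 2 ^ d) * zetaReal d) := by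
  have hz := hasSum_zetaReal hd
  have hs : Summable (fun n : ℕ => 1 / (2 * (n : ℝ) + 1) ^ d) := by
    simpa [Function.comp_def] using
      hz.summable.comp_injective (mul_right_injective₀ (two_ne_zero' ℕ))
  have ho : HasSum (fun n : ℕ => 1 / (((2 * n + 1 : ℕ) : ℝ) + 1) ^ d)
      (1 / 2 ^ d * zetaReal d) := by
    refine (hz.mul_left (1 / 2 ^ d)).congr_fun ?_
    intro n
    rw [one_div_mul_one_div, ← Real.mul_rpow (by norm_num) (by positivity)]
    push_cast
    ring_nf
  have h := HasSum.even_add_odd (f := fun n : ℕ => 1 / ((n : ℝ) + 1) ^ d)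
    (by push_cast; exact hs.hasSum) ho
  convert! hs.hasSum using 1
  linarith [h.unique hz]

/-- Closed form of the inner series, in terms of consecutive odd numbers. -/
lemma one_div_rpow_mul_even_part (d : ℝ) (j : ℕ) :
    1 / ((j : ℝ) + 1) ^ d *
        ((1 / (1 - 1 / (2 * ((j : ℝ) + 1))) ^ d + 1 / (1 + 1 / (2 * ((j : ℝ) + 1))) ^ d) / 2 - 1) =
      2 ^ (d - 1) * (1 / (2 * (j : ℝ) + 1) ^ d + 1 / (2 * ((j + 1 : ℕ) : ℝ) + 1) ^ d) -
        1 / ((j : ℝ) + 1) ^ d := by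
  have hj : (0 : ℝ) < (j : ℝ) + 1 := by positivity
  have h1 : 1 - 1 / (2 * ((j : ℝ) + 1)) = (2 * (j : ℝ) + 1) / (2 * ((j : ℝ) + 1)) := by
    field_simp
    ring
  have h2 : 1 + 1 / (2 * ((j : ℝ) + 1)) =
      (2 * ((j + 1 : ℕ) : ℝ) + 1) / (2 * ((j : ℝ) + 1)) := by
    push_cast
    field_simp
  rw [h1, h2, Real.div_rpow (by positivity) (by positivity),
    Real.div_rpow (by positivity) (by positivity), Real.mul_rpow (by norm_num) hj.le,
    Real.rpow_sub_one (by norm_num)]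
  have hA : ((j : ℝ) + 1) ^ d ≠ 0 := by positivity
  have hB : (2 * (j : ℝ) + 1) ^ d ≠ 0 := by positivity
  have hC : (2 * ((j + 1 : ℕ) : ℝ) + 1) ^ d ≠ 0 := by positivity
  field_simp

/-- For every real `d > 1`,
`Σ_{j=1}^{∞} j^{−d} Σ_{q=1}^{∞} (d)_{2q}/((2q)!(2j)^{2q}) = 2^d ζ(d) − 2ζ(d) − 2^{d−1}`,
where `(d)_m` is the Pochhammer symbol (rising factorial) and both series converge
absolutely. -/
theorem pochhammer_zeta_identity (d : ℝ) (hd : 1 < d) :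
    (∀ j : ℕ, Summable fun q : ℕ =>
        |(ascPochhammer ℝ (2 * (q + 1))).eval d /
          ((Nat.factorial (2 * (q + 1)) : ℝ) * (2 * ((j : ℝ) + 1)) ^ (2 * (q + 1)))|) ∧
    (Summable fun j : ℕ =>
        |(1 / ((j : ℝ) + 1) ^ d) * ∑' q : ℕ,
          (ascPochhammer ℝ (2 * (q + 1))).eval d /
            ((Nat.factorial (2 * (q + 1)) : ℝ) * (2 * ((j : ℝ) + 1)) ^ (2 * (q + 1)))|) ∧
    (∑' j : ℕ, (1 / ((j : ℝ) + 1) ^ d) * ∑' q : ℕ,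
        (ascPochhammer ℝ (2 * (q + 1))).eval d /
          ((Nat.factorial (2 * (q + 1)) : ℝ) * (2 * ((j : ℝ) + 1)) ^ (2 * (q + 1)))) =
      2 ^ d * zetaReal d - 2 * zetaReal d - 2 ^ (d - 1) := by
  have hterm (j q : ℕ) : (ascPochhammer ℝ (2 * (q + 1))).eval d /
      ((Nat.factorial (2 * (q + 1)) : ℝ) * (2 * ((j : ℝ) + 1)) ^ (2 * (q + 1))) =
      (ascPochhammer ℝ (2 * (q + 1))).eval d / (Nat.factorial (2 * (q + 1)) : ℝ) *
        (1 / (2 * ((j : ℝ) + 1))) ^ (2 * (q + 1)) := by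
    rw [one_div_pow, div_mul_div_comm, mul_one]
  have hx (j : ℕ) : |1 / (2 * ((j : ℝ) + 1))| < 1 := by
    rw [abs_of_pos (by positivity), div_lt_one (by positivity)]
    have : (0 : ℝ) ≤ j := j.cast_nonneg
    linarith
  simp only [hterm]
  have hin (j : ℕ) := hasSum_ascPochhammer_even_succ d (hx j)
  simp only [fun j => (hin j).tsum_eq, one_div_rpow_mul_even_part]
  have hodd := hasSum_one_div_odd_rpow hd
  have hout := ((hodd.add ((hasSum_nat_add_iff' 1).mpr hodd)).mul_left (2 ^ (d - 1))).sub
    (hasSum_zetaReal hd)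
  refine ⟨fun j => (hin j).summable.abs, hout.summable.abs, hout.tsum_eq.trans ?_⟩
  rw [Real.rpow_sub_one (by norm_num)]
  simp only [Finset.sum_range_one, Nat.cast_zero, mul_zero, zero_add, Real.one_rpow, div_one]
  field_simp
  ring
end

section
/- Let m be a positive integer and let f(x) = arccos(x^{2m}) for x ∈ [−1,1], with Chebyshev coefficients a_k. Then a_{2n+1} = 0 for all n ≥ 0, and as n → ∞, a_{2n} = μ_0/n² + μ_1/n⁴ + μ_2/n⁶ + O(n^{−8}), where μ_0 = −√(2m)/π, μ_1 = −(√(2m)/(4π))(m − 1/2), and μ_2 = −(√(2m)/(16π))(m² − 5m + 9/4). -/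
open Real Filter Finset

open scoped ContDiff

/-- The operator `F ↦ (1 - x²) F'' - x F'`, which represents the second derivative in `t` of
`F (cos t)`. -/
noncomputable def chebOp (F : ℝ → ℝ) (x : ℝ) : ℝ :=
  (1 - x ^ 2) * deriv (deriv F) x - x * deriv F x

lemma contDiff_deriv {F : ℝ → ℝ} (hF : ContDiff ℝ ∞ F) : ContDiff ℝ ∞ (deriv F) :=
  (contDiff_infty_iff_deriv.1 hF).2

lemma ContDiff.hasDerivAt_deriv {F : ℝ → ℝ} (hF : ContDiff ℝ ∞ F) (x : ℝ) :
    HasDerivAt F (deriv F x) x :=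
  ((contDiff_infty_iff_deriv.1 hF).1 x).hasDerivAt

lemma contDiff_chebOp {F : ℝ → ℝ} (hF : ContDiff ℝ ∞ F) : ContDiff ℝ ∞ (chebOp F) := by
  have h1 := contDiff_deriv hF
  have h2 := contDiff_deriv h1
  unfold chebOp
  fun_prop

lemma deriv_neg_of_odd {F : ℝ → ℝ} (h : ∀ x, F (-x) = -F x) (x : ℝ) :
    deriv F (-x) = deriv F x := by
  have h1 := deriv_comp_neg F x
  simp only [h, deriv.fun_neg] at h1
  linarith

lemma deriv_neg_of_even {F : ℝ → ℝ} (h : ∀ x, F (-x) = F x) (x : ℝ) :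
    deriv F (-x) = -deriv F x := by
  have h1 := deriv_comp_neg F x
  simp only [h] at h1
  linarith

lemma chebOp_odd {F : ℝ → ℝ} (h : ∀ x, F (-x) = -F x) (x : ℝ) :
    chebOp F (-x) = -chebOp F x := by
  simp only [chebOp, deriv_neg_of_even (deriv_neg_of_odd h), deriv_neg_of_odd h]
  ring

lemma chebOp_one (F : ℝ → ℝ) : chebOp F 1 = -deriv F 1 := by
  simp [chebOp]

lemma chebOp_chebOp_one {F : ℝ → ℝ} (hF : ContDiff ℝ ∞ F) :
    chebOp (chebOp F) 1 = 3 * deriv (deriv F) 1 + deriv F 1 := by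
  have h1 := contDiff_deriv hF
  have h2 := contDiff_deriv h1
  have h : HasDerivAt (chebOp F) _ 1 :=
    (((hasDerivAt_pow 2 (1 : ℝ)).const_sub 1).mul (h2.hasDerivAt_deriv 1)).sub
      ((hasDerivAt_id (1 : ℝ)).mul (h1.hasDerivAt_deriv 1))
  rw [chebOp_one, h.deriv]
  simp
  ring

/-- The sine coefficient integral `∫₀^π F (cos t) sin (k t) dt`. -/
noncomputable def sinIntegral (F : ℝ → ℝ) (k : ℝ) : ℝ :=
  ∫ t in (0 : ℝ)..π, F (cos t) * sin (k * t)

lemma hasDerivAt_sin_mul (k t : ℝ) : HasDerivAt (fun t => sin (k * t)) (k * cos (k * t)) t := by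
  have h := ((hasDerivAt_id t).const_mul k).sin
  simpa [mul_comm] using h

lemma hasDerivAt_cos_mul (k t : ℝ) : HasDerivAt (fun t => cos (k * t)) (-(k * sin (k * t))) t := by
  have h := ((hasDerivAt_id t).const_mul k).cos
  simpa [mul_comm] using h

lemma sin_natCast_two_mul_pi (n : ℕ) : sin ((2 * n : ℝ) * π) = 0 := by
  have := sin_nat_mul_pi (2 * n)
  push_cast at this
  exact this

lemma cos_natCast_two_mul_pi (n : ℕ) : cos ((2 * n : ℝ) * π) = 1 := by
  rw [show (2 * n : ℝ) * π = n * (2 * π) by ring]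
  exact cos_nat_mul_two_pi n

lemma sinIntegral_eq {F : ℝ → ℝ} (hF : ContDiff ℝ ∞ F) (hodd : ∀ x, F (-x) = -F x)
    {n : ℕ} (hn : n ≠ 0) :
    sinIntegral F (2 * n) =
      2 * F 1 / (2 * n) - sinIntegral (chebOp F) (2 * n) / (2 * n) ^ 2 := by
  have hsin := sin_natCast_two_mul_pi n
  have hcos := cos_natCast_two_mul_pi n
  have hk : (2 * n : ℝ) ≠ 0 := by positivity
  set k : ℝ := 2 * n
  have hF1 := contDiff_deriv hF
  have hF2 := contDiff_deriv hF1
  have hD := contDiff_chebOp hF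
  have d0 (t : ℝ) : HasDerivAt (fun t => F (cos t)) (deriv F (cos t) * -sin t) t :=
    (hF.hasDerivAt_deriv (cos t)).comp t (hasDerivAt_cos t)
  have d1 (t : ℝ) : HasDerivAt (fun t => deriv F (cos t) * -sin t) (chebOp F (cos t)) t := by
    have h := ((hF1.hasDerivAt_deriv (cos t)).comp t (hasDerivAt_cos t)).mul
      (hasDerivAt_sin t).neg
    refine h.congr_deriv ?_
    simp only [chebOp, Function.comp_apply, Pi.neg_apply]
    linear_combination deriv (deriv F) (cos t) * sin_sq_add_cos_sq t
  have i1 := intervalIntegral.integral_mul_deriv_eq_deriv_mul (a := 0) (b := π)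
    (fun t _ => d0 t) (fun t _ => hasDerivAt_cos_mul k t)
    (by apply Continuous.intervalIntegrable; have := hF1.continuous; fun_prop)
    (by apply Continuous.intervalIntegrable; fun_prop)
  have i2 := intervalIntegral.integral_mul_deriv_eq_deriv_mul (a := 0) (b := π)
    (fun t _ => d1 t) (fun t _ => hasDerivAt_sin_mul k t)
    (by apply Continuous.intervalIntegrable; have := hD.continuous; fun_prop)
    (by apply Continuous.intervalIntegrable; fun_prop)
  have e1 : ∫ t in (0 : ℝ)..π, F (cos t) * -(k * sin (k * t)) = -k * sinIntegral F k := by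
    rw [sinIntegral, ← intervalIntegral.integral_const_mul]
    congr 1; ext t; ring
  have e2 : ∫ t in (0 : ℝ)..π, deriv F (cos t) * -sin t * (k * cos (k * t)) =
      k * ∫ t in (0 : ℝ)..π, deriv F (cos t) * -sin t * cos (k * t) := by
    rw [← intervalIntegral.integral_const_mul]
    congr 1; ext t; ring
  rw [e1] at i1
  rw [e2] at i2
  simp only [cos_pi, cos_zero, sin_pi, sin_zero, mul_zero, hsin, hcos, hodd 1] at i1 i2
  change _ = _ - sinIntegral (chebOp F) k at i2
  field_simp
  linear_combination (-k) * i1 + i2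

lemma abs_sinIntegral_le {F : ℝ → ℝ} (hF : ContDiff ℝ ∞ F) :
    ∃ C, ∀ k, |sinIntegral F k| ≤ C := by
  obtain ⟨C, hC⟩ := (isCompact_Icc (a := (-1 : ℝ)) (b := 1)).exists_bound_of_continuousOn
    hF.continuous.continuousOn
  refine ⟨C * |π - 0|, fun k => ?_⟩
  refine intervalIntegral.norm_integral_le_of_norm_le_const (f := fun t => F (cos t) * sin (k * t))
    fun t _ => ?_
  have h1 := hC (cos t) ⟨neg_one_le_cos t, cos_le_one t⟩
  rw [norm_mul]
  calc ‖F (cos t)‖ * ‖sin (k * t)‖ ≤ ‖F (cos t)‖ * 1 := by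
        gcongr; exact abs_sin_le_one _
    _ ≤ C := by linarith

lemma abs_sinIntegral_le_div {F : ℝ → ℝ} (hF : ContDiff ℝ ∞ F) (hodd : ∀ x, F (-x) = -F x) :
    ∃ C, ∀ n : ℕ, n ≠ 0 → |sinIntegral F (2 * n)| ≤ C / n := by
  obtain ⟨C, hC⟩ := abs_sinIntegral_le (contDiff_chebOp hF)
  refine ⟨|F 1| + C, fun n hn => ?_⟩
  have hC0 : 0 ≤ C := (abs_nonneg _).trans (hC 0)
  have hn1 : (1 : ℝ) ≤ n := by exact_mod_cast Nat.one_le_iff_ne_zero.2 hn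
  have hn0 : (0 : ℝ) < n := by positivity
  rw [sinIntegral_eq hF hodd hn]
  refine (abs_sub _ _).trans ?_
  rw [add_div]
  refine add_le_add (le_of_eq ?_) ?_
  · rw [abs_div, abs_mul, abs_of_pos (by positivity : (0 : ℝ) < 2 * n)]
    simp only [Nat.abs_ofNat]
    field_simp
  · rw [abs_div, abs_of_pos (by positivity : (0 : ℝ) < (2 * n) ^ 2)]
    exact div_le_div₀ hC0 (hC _) hn0 (by nlinarith)

/-- The even geometric sum `∑_{j < N} x^{2j}`. -/
noncomputable def evenGeom (N : ℕ) (x : ℝ) : ℝ := ∑ j ∈ range N, (x ^ 2) ^ j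

lemma evenGeom_mul (N : ℕ) (x : ℝ) : (1 - x ^ 2) * evenGeom N x = 1 - x ^ (2 * N) := by
  have := mul_geom_sum (x ^ 2) N
  rw [evenGeom, pow_mul]
  linarith

lemma evenGeom_pos (N : ℕ) (x : ℝ) : 0 < evenGeom (N + 1) x := by
  rw [evenGeom, sum_range_succ', pow_zero]
  positivity

lemma evenGeom_neg (N : ℕ) (x : ℝ) : evenGeom N (-x) = evenGeom N x := by
  simp [evenGeom]

lemma contDiff_evenGeom (N : ℕ) : ContDiff ℝ ∞ (evenGeom N) := by
  unfold evenGeom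
  fun_prop

lemma hasDerivAt_unique_of_eq {f g : ℝ → ℝ} {a b x : ℝ} (hf : HasDerivAt f a x)
    (hg : HasDerivAt g b x) (h : ∀ x, f x = g x) : a = b := by
  obtain rfl : f = g := funext h
  exact hf.unique hg

lemma hasDerivAt_mul_pow (c : ℝ) (n : ℕ) (x : ℝ) :
    HasDerivAt (fun x => c * x ^ (n + 1)) (c * (n + 1) * x ^ n) x := by
  refine ((hasDerivAt_pow (n + 1) x).const_mul c).congr_deriv ?_
  push_cast
  simp [mul_assoc]

lemma evenGeom_one (N : ℕ) : evenGeom N 1 = N := by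
  simp [evenGeom]

lemma deriv_evenGeom (N : ℕ) (x : ℝ) :
    -(2 * x) * evenGeom (N + 2) x + (1 - x ^ 2) * deriv (evenGeom (N + 2)) x =
      -(2 * N + 4) * x ^ (2 * N + 3) := by
  have hq := (contDiff_evenGeom (N + 2)).hasDerivAt_deriv
  have h := hasDerivAt_unique_of_eq (((hasDerivAt_pow 2 x).const_sub 1).mul (hq x))
    ((hasDerivAt_mul_pow 1 (2 * N + 3) x).const_sub 1)
    (fun x => by simpa [mul_add, add_assoc] using evenGeom_mul (N + 2) x)
  push_cast at h
  linear_combination h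

lemma deriv_deriv_evenGeom (N : ℕ) (x : ℝ) :
    -2 * evenGeom (N + 2) x - 4 * x * deriv (evenGeom (N + 2)) x +
        (1 - x ^ 2) * deriv (deriv (evenGeom (N + 2))) x =
      -(2 * N + 4) * (2 * N + 3) * x ^ (2 * N + 2) := by
  have hq := (contDiff_evenGeom (N + 2)).hasDerivAt_deriv
  have hq1 := (contDiff_deriv (contDiff_evenGeom (N + 2))).hasDerivAt_deriv
  have h := hasDerivAt_unique_of_eq
    ((((hasDerivAt_id x).const_mul 2).neg.mul (hq x)).add
      (((hasDerivAt_pow 2 x).const_sub 1).mul (hq1 x)))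
    (hasDerivAt_mul_pow (-(2 * N + 4)) (2 * N + 2) x) (deriv_evenGeom N)
  simp at h
  linear_combination h

lemma deriv_evenGeom_one (N : ℕ) : deriv (evenGeom (N + 2)) 1 = (N + 2) * (N + 1) := by
  have h := deriv_deriv_evenGeom N 1
  simp [evenGeom_one] at h
  linear_combination (-1 / 4) * h

lemma deriv_deriv_evenGeom_one (N : ℕ) :
    deriv (deriv (evenGeom (N + 2))) 1 = (N + 2) * (N + 1) * (4 * N + 3) / 3 := by
  have hq := (contDiff_evenGeom (N + 2)).hasDerivAt_deriv
  have hq1 := (contDiff_deriv (contDiff_evenGeom (N + 2))).hasDerivAt_deriv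
  have hq2 := (contDiff_deriv (contDiff_deriv (contDiff_evenGeom (N + 2)))).hasDerivAt_deriv
  have h := hasDerivAt_unique_of_eq
    ((((hq 1).const_mul (-2)).sub (((hasDerivAt_id (1 : ℝ)).const_mul 4).mul (hq1 1))).add
      (((hasDerivAt_pow 2 (1 : ℝ)).const_sub 1).mul (hq2 1)))
    (hasDerivAt_mul_pow (-(2 * N + 4) * (2 * N + 3)) (2 * N + 1) 1) (deriv_deriv_evenGeom N)
  simp [deriv_evenGeom_one] at h
  linear_combination (-1 / 6) * h

/-- On `(0, π)` the derivative of `arccos (cos t ^ (2 (p + 1)))` is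
`arccosPowSlope p (cos t)`. -/
noncomputable def arccosPowSlope (p : ℕ) (x : ℝ) : ℝ :=
  2 * (p + 1) * x ^ (2 * p + 1) / √(evenGeom (2 * p + 2) x)

lemma contDiff_arccosPowSlope (p : ℕ) : ContDiff ℝ ∞ (arccosPowSlope p) := by
  unfold arccosPowSlope
  refine ContDiff.div (by fun_prop) ((contDiff_evenGeom _).sqrt fun x => ?_) fun x => ?_
  · exact (evenGeom_pos _ x).ne'
  · exact (sqrt_pos.2 (evenGeom_pos _ x)).ne'

lemma arccosPowSlope_neg (p : ℕ) (x : ℝ) : arccosPowSlope p (-x) = -arccosPowSlope p x := by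
  rw [arccosPowSlope, arccosPowSlope, evenGeom_neg, Odd.neg_pow ⟨p, rfl⟩]
  ring

lemma arccosPowSlope_one (p : ℕ) : arccosPowSlope p 1 = √(2 * (p + 1 : ℕ)) := by
  rw [arccosPowSlope, evenGeom_one, one_pow, mul_one]
  push_cast
  rw [mul_add_one (2 : ℝ) (p : ℝ)]
  exact div_sqrt

lemma arccosPowSlope_sq_mul (p : ℕ) (x : ℝ) :
    arccosPowSlope p x ^ 2 * evenGeom (2 * p + 2) x =
      4 * (p + 1) ^ 2 * x ^ (4 * p + 2) := by
  have h := evenGeom_pos (2 * p + 1) x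
  rw [arccosPowSlope, div_pow, sq_sqrt h.le, div_mul_cancel₀ _ h.ne']
  ring

lemma deriv_arccosPowSlope (p : ℕ) (x : ℝ) :
    2 * (arccosPowSlope p x * deriv (arccosPowSlope p) x * evenGeom (2 * p + 2) x) +
        arccosPowSlope p x ^ 2 * deriv (evenGeom (2 * p + 2)) x =
      4 * (p + 1) ^ 2 * (4 * p + 2) * x ^ (4 * p + 1) := by
  have hq := (contDiff_evenGeom (2 * p + 2)).hasDerivAt_deriv
  have hf := (contDiff_arccosPowSlope p).hasDerivAt_deriv
  have h := hasDerivAt_unique_of_eq (((hf x).pow 2).mul (hq x))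
    (hasDerivAt_mul_pow (4 * (p + 1) ^ 2) (4 * p + 1) x) (arccosPowSlope_sq_mul p)
  simp at h
  linear_combination h

lemma deriv_arccosPowSlope_one (p : ℕ) :
    deriv (arccosPowSlope p) 1 = √(2 * (p + 1 : ℕ)) * (2 * p + 1) / 2 := by
  have h := deriv_arccosPowSlope p 1
  have hq := deriv_evenGeom_one (2 * p)
  have hs : √(2 * (p + 1 : ℕ)) ^ 2 = 2 * (p + 1) := by
    rw [sq_sqrt (by positivity)]; push_cast; ring
  have hs0 : √(2 * (p + 1 : ℕ)) ≠ 0 := (sqrt_pos.2 (by positivity)).ne'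
  rw [arccosPowSlope_one, hq, evenGeom_one] at h
  set s := √(2 * (p + 1 : ℕ))
  have hp : (p + 1 : ℝ) ≠ 0 := by positivity
  push_cast at h
  apply mul_left_cancel₀ (mul_ne_zero hs0 hp)
  linear_combination (1 / 4) * h - (2 * p + 1) * (p + 1) * hs

lemma deriv_deriv_arccosPowSlope_one (p : ℕ) :
    deriv (deriv (arccosPowSlope p)) 1 =
      √(2 * (p + 1 : ℕ)) * ((p + 1) ^ 2 - 6 * (p + 1) + 11 / 4) / 3 := by
  have cf := contDiff_arccosPowSlope p
  have cq := contDiff_evenGeom (2 * p + 2)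
  have hf := cf.hasDerivAt_deriv
  have hf1 := (contDiff_deriv cf).hasDerivAt_deriv
  have hq := cq.hasDerivAt_deriv
  have hq1 := (contDiff_deriv cq).hasDerivAt_deriv
  have h := hasDerivAt_unique_of_eq
    (((((hf 1).mul (hf1 1)).mul (hq 1)).const_mul 2).add (((hf 1).pow 2).mul (hq1 1)))
    (hasDerivAt_mul_pow (4 * (p + 1) ^ 2 * (4 * p + 2)) (4 * p) 1) (deriv_arccosPowSlope p)
  have hs : √(2 * (p + 1 : ℕ)) ^ 2 = 2 * (p + 1) := by
    rw [sq_sqrt (by positivity)]; push_cast; ring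
  have hs0 : √(2 * (p + 1 : ℕ)) ≠ 0 := (sqrt_pos.2 (by positivity)).ne'
  simp only [Pi.mul_apply, Pi.pow_apply, arccosPowSlope_one, deriv_arccosPowSlope_one,
    deriv_evenGeom_one, deriv_deriv_evenGeom_one, evenGeom_one] at h
  set s := √(2 * (p + 1 : ℕ))
  have hp : (p + 1 : ℝ) ≠ 0 := by positivity
  push_cast at h
  apply mul_left_cancel₀ (mul_ne_zero hs0 hp)
  linear_combination (1 / 4) * h - (1 / 4) *
    (4 * (p + 1) * ((p + 1) ^ 2 - 6 * (p + 1) + 11 / 4) / 3 + (2 * p + 1) ^ 2 * (p + 1) +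
      4 * (2 * p + 1) ^ 2 * (p + 1) + (2 * p + 2) * (2 * p + 1) * (8 * p + 3) / 3) * hs

lemma hasDerivAt_arccos_cos_pow (p : ℕ) {t : ℝ} (ht : t ∈ Set.Ioo 0 π) :
    HasDerivAt (fun t => arccos (cos t ^ (2 * (p + 1)))) (arccosPowSlope p (cos t)) t := by
  have hs : 0 < sin t := sin_pos_of_mem_Ioo ht
  have hq := evenGeom_pos (2 * p + 1) (cos t)
  have key : 1 - (cos t ^ (2 * (p + 1))) ^ 2 = sin t ^ 2 * evenGeom (2 * p + 2) (cos t) := by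
    have := evenGeom_mul (2 * p + 2) (cos t)
    rw [sin_sq, this]
    ring
  have hpos : 0 < 1 - (cos t ^ (2 * (p + 1))) ^ 2 := by rw [key]; positivity
  have h := (hasDerivAt_arccos (x := cos t ^ (2 * (p + 1))) (by intro h; norm_num [h] at hpos)
    (by intro h; norm_num [h] at hpos)).comp t ((hasDerivAt_cos t).pow (2 * (p + 1)))
  refine h.congr_deriv ?_
  rw [key, sqrt_mul (sq_nonneg _), sqrt_sq hs.le, arccosPowSlope]
  have hq' := (sqrt_pos.2 hq).ne'
  rw [show 2 * (p + 1) - 1 = 2 * p + 1 by omega]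
  push_cast
  field_simp

lemma chebCoeff_arccos_pow_even (p : ℕ) {n : ℕ} (hn : n ≠ 0) :
    chebCoeff (fun x => arccos (x ^ (2 * (p + 1)))) (2 * n) =
      -(2 / π) * sinIntegral (arccosPowSlope p) (2 * n) / (2 * n) := by
  have hk : (2 * n : ℝ) ≠ 0 := by positivity
  have hsin := sin_natCast_two_mul_pi n
  have i := intervalIntegral.integral_mul_deriv_eq_deriv_mul_of_hasDerivAt (a := 0) (b := π)
    (u := fun t => arccos (cos t ^ (2 * (p + 1)))) (u' := fun t => arccosPowSlope p (cos t))
    (v := fun t => sin (2 * n * t)) (v' := fun t => 2 * n * cos (2 * n * t))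
    (by have := continuous_arccos; fun_prop) (by fun_prop)
    (fun t ht => hasDerivAt_arccos_cos_pow p (by simpa [pi_pos.le] using ht))
    (fun t _ => hasDerivAt_sin_mul (2 * n) t)
    (by
      apply Continuous.intervalIntegrable
      have := (contDiff_arccosPowSlope p).continuous
      fun_prop)
    (by apply Continuous.intervalIntegrable; fun_prop)
  have e : ∫ t in (0 : ℝ)..π, arccos (cos t ^ (2 * (p + 1))) * (2 * n * cos (2 * n * t)) =
      2 * n * ∫ t in (0 : ℝ)..π, arccos (cos t ^ (2 * (p + 1))) * cos (2 * n * t) := by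
    rw [← intervalIntegral.integral_const_mul]
    congr 1; ext t; ring
  rw [e] at i
  simp only [hsin, mul_zero, sin_zero, sub_zero, zero_sub] at i
  change _ = -sinIntegral (arccosPowSlope p) (2 * n) at i
  rw [chebCoeff]
  push_cast
  rw [mul_div_assoc, neg_mul, ← mul_neg, ← neg_div, ← i, mul_div_cancel_left₀ _ hk]

lemma chebCoeff_odd_eq_zero {f : ℝ → ℝ} (hf : ∀ x, f (-x) = f x) (n : ℕ) :
    chebCoeff f (2 * n + 1) = 0 := by
  have h := intervalIntegral.integral_comp_sub_left (a := 0) (b := π)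
    (fun t => f (cos t) * cos ((2 * n + 1 : ℕ) * t)) π
  have e : ∀ t, f (cos (π - t)) * cos ((2 * n + 1 : ℕ) * (π - t)) =
      -(f (cos t) * cos ((2 * n + 1 : ℕ) * t)) := by
    intro t
    have : ((2 * n + 1 : ℕ) : ℝ) * (π - t) = π - (2 * n + 1 : ℕ) * t + n * (2 * π) := by
      push_cast; ring
    rw [this, cos_add_nat_mul_two_pi, cos_pi_sub, cos_pi_sub, hf]
    ring
  simp only [e, intervalIntegral.integral_neg, sub_zero, sub_self] at h
  rw [chebCoeff, show (∫ t in (0 : ℝ)..π, f (cos t) * cos ((2 * n + 1 : ℕ) * t)) = 0 by linarith,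
    mul_zero]

/-- For `f(x) = arccos(x^{2m})` with `m ≥ 1`: the odd Chebyshev coefficients vanish,
and `a_{2n} = μ₀/n² + μ₁/n⁴ + μ₂/n⁶ + O(n^{−8})` with `μ₀ = −√(2m)/π`,
`μ₁ = −(√(2m)/(4π))(m − 1/2)` and `μ₂ = −(√(2m)/(16π))(m² − 5m + 9/4)`. -/
theorem chebCoeff_arccos_pow (m : ℕ) (hm : 1 ≤ m) :
    (∀ n : ℕ, chebCoeff (fun x => Real.arccos (x ^ (2 * m))) (2 * n + 1) = 0) ∧
    (fun n : ℕ => chebCoeff (fun x => Real.arccos (x ^ (2 * m))) (2 * n) -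
        (-(Real.sqrt (2 * m)) / π / (n : ℝ) ^ 2 +
          -(Real.sqrt (2 * m) / (4 * π)) * ((m : ℝ) - 1 / 2) / (n : ℝ) ^ 4 +
          -(Real.sqrt (2 * m) / (16 * π)) * ((m : ℝ) ^ 2 - 5 * (m : ℝ) + 9 / 4) /
            (n : ℝ) ^ 6))
      =O[atTop] fun n : ℕ => (n : ℝ) ^ (-8 : ℝ) := by
  obtain ⟨p, rfl⟩ : ∃ p, m = p + 1 := ⟨m - 1, by omega⟩
  refine ⟨chebCoeff_odd_eq_zero fun x => by rw [Even.neg_pow ⟨p + 1, by ring⟩], ?_⟩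
  have c0 := contDiff_arccosPowSlope p
  have o0 := arccosPowSlope_neg p
  have c1 := contDiff_chebOp c0
  have o1 := chebOp_odd o0
  have c2 := contDiff_chebOp c1
  have o2 := chebOp_odd o1
  obtain ⟨C, hC⟩ := abs_sinIntegral_le_div (contDiff_chebOp c2) (chebOp_odd o2)
  refine Asymptotics.IsBigO.of_bound (2 / π * C / 2 ^ 7) ?_
  filter_upwards [eventually_ne_atTop 0] with n hn
  have hR := hC n hn
  rw [chebCoeff_arccos_pow_even p hn, sinIntegral_eq c0 o0 hn, sinIntegral_eq c1 o1 hn,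
    sinIntegral_eq c2 o2 hn, chebOp_chebOp_one c0, chebOp_one, arccosPowSlope_one,
    deriv_arccosPowSlope_one, deriv_deriv_arccosPowSlope_one]
  set R := sinIntegral (chebOp (chebOp (chebOp (arccosPowSlope p)))) (2 * n)
  set s := √(2 * (p + 1 : ℕ))
  have hn0 : (0 : ℝ) < n := by positivity
  have hpow : (n : ℝ) ^ (-8 : ℝ) = ((n : ℝ) ^ 8)⁻¹ := by
    rw [rpow_neg hn0.le]
    norm_cast
  have hπ := pi_pos
  have key : (2 / π) * R / (2 * n) ^ 7 = (2 / π / 2 ^ 7 / n ^ 7) * R := by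
    field_simp
  calc _ = ‖(2 / π) * R / (2 * n) ^ 7‖ := by
        congr 1
        push_cast
        field_simp
        ring
    _ = (2 / π / 2 ^ 7 / n ^ 7) * |R| := by
        rw [key, norm_mul, norm_of_nonneg (by positivity), norm_eq_abs]
    _ ≤ (2 / π / 2 ^ 7 / n ^ 7) * (C / n) := by gcongr
    _ = _ := by
        rw [hpow, norm_of_nonneg (by positivity)]
        field_simp
end
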